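/- arXiv:2110.11216 — 5 statements merged into one kernel-verified Lean document; each statement's English description precedes it below -/
import Mathlib

section
/- Localized oracle PAC-Bayes bound: assume the Bernstein assumption holds with constant K > 0 (for every θ ∈ Θ, E_{(X,Y)∼P}[ (ℓ(f_θ(X),Y) − ℓ(f_{θ*}(X),Y))² ] ≤ K ( R(θ) − R(θ*) ), where R(θ*) = min_θ R(θ)), and take λ = n / max(2K, C). Then the Gibbs posterior ρ̂_λ with density proportional to exp(−λ r(θ)) with respect to π satisfies E_S { E_{θ∼ρ̂_λ}[R(θ)] − R(θ*) } ≤ inf over ρ ∈ P(Θ) of ( 3 E_{θ∼ρ}[R(θ) − R(θ*)] + 4 max(2K, C) · KL(ρ‖π_{−(λ/4)R}) / n ), where π_{−(λ/4)R} is the probability measure with density proportional to exp(−(λ/4) R(θ)) with respect to π. -/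
open MeasureTheory
open scoped ENNReal

/- Kullback-Leibler divergence: `∫ log (dρ/dπ) dρ` when `ρ ≪ π` (and the integral is
well-defined), `+∞` otherwise. -/
open Classical in
noncomputable def KL {Θ : Type*} [MeasurableSpace Θ] (ρ π : Measure Θ) : ℝ≥0∞ :=
  if ρ ≪ π ∧ Integrable (fun θ => Real.log ((ρ.rnDeriv π) θ).toReal) ρ
  then ENNReal.ofReal (∫ θ, Real.log ((ρ.rnDeriv π) θ).toReal ∂ρ)
  else ⊤

/- The risk `R(θ) = E_{(X,Y)∼P}[ℓ(f_θ(X),Y)]`. -/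
noncomputable def risk {X Y Θ : Type*} [MeasurableSpace X] [MeasurableSpace Y]
    (P : Measure (X × Y)) (f : Θ → X → Y) (ℓ : Y → Y → ℝ) (θ : Θ) : ℝ :=
  ∫ p, ℓ (f θ p.1) p.2 ∂P

/- The empirical risk `r(θ) = (1/n) ∑ᵢ ℓ(f_θ(Xᵢ),Yᵢ)` on the sample `ω`. -/
noncomputable def empRisk {X Y Θ : Type*} (f : Θ → X → Y) (ℓ : Y → Y → ℝ)
    (n : ℕ) (ω : Fin n → X × Y) (θ : Θ) : ℝ :=
  (∑ i, ℓ (f θ (ω i).1) (ω i).2) / n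

/- The Gibbs posterior `ρ̂_λ`, with density proportional to `exp (-λ r θ)` w.r.t. `π`. -/
noncomputable def gibbs {X Y Θ : Type*} [MeasurableSpace Θ] (π : Measure Θ)
    (f : Θ → X → Y) (ℓ : Y → Y → ℝ) (lam : ℝ) (n : ℕ) (ω : Fin n → X × Y) : Measure Θ :=
  π.tilted (fun θ => -lam * empRisk f ℓ n ω θ)

section BoundedFunctions

variable {α : Type*} [MeasurableSpace α] {μ : Measure α} {h : α → ℝ} {B : ℝ}

lemma integrable_of_abs_le [IsFiniteMeasure μ] (hm : Measurable h) (hb : ∀ x, |h x| ≤ B) :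
    Integrable h μ :=
  .of_bound hm.aestronglyMeasurable B (ae_of_all _ hb)

lemma integrable_exp_of_abs_le [IsFiniteMeasure μ] (hm : Measurable h) (hb : ∀ x, |h x| ≤ B) :
    Integrable (fun x => Real.exp (h x)) μ :=
  integrable_of_abs_le (B := Real.exp B) hm.exp fun x => by
    rw [Real.abs_exp]
    exact Real.exp_le_exp.2 ((le_abs_self _).trans (hb x))

lemma abs_integral_le_of_abs_le [IsProbabilityMeasure μ] (hb : ∀ x, |h x| ≤ B) :
    |∫ x, h x ∂μ| ≤ B := by
  simpa using norm_integral_le_of_norm_le_const (μ := μ) (f := h) (ae_of_all _ hb)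

end BoundedFunctions

section Variational

variable {Θ : Type*} [MeasurableSpace Θ]

/-- The Donsker-Varadhan inequality for bounded functions. -/
lemma integral_sub_integral_llr_le_log_integral_exp {ρ π : Measure Θ} [IsProbabilityMeasure ρ]
    [IsProbabilityMeasure π] (hac : ρ ≪ π) (hint : Integrable (llr ρ π) ρ)
    {h : Θ → ℝ} {B : ℝ} (hm : Measurable h) (hb : ∀ θ, |h θ| ≤ B) :
    ∫ θ, h θ ∂ρ - ∫ θ, llr ρ π θ ∂ρ ≤ Real.log (∫ θ, Real.exp (h θ) ∂π) := by
  have hexp : Integrable (fun θ => Real.exp (h θ)) π := integrable_exp_of_abs_le hm hb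
  have hρ : Integrable h ρ := integrable_of_abs_le hm hb
  have := isProbabilityMeasure_tilted hexp
  have h1 := integral_llr_tilted_right hac hρ hexp hint
  have h2 := InformationTheory.integral_llr_add_sub_measure_univ_nonneg
    (hac.trans (absolutelyContinuous_tilted hexp))
    (integrable_llr_tilted_right hac hρ hint hexp)
  simp only [probReal_univ] at h2
  linarith

lemma integral_le_log_integral_exp {π : Measure Θ} [IsProbabilityMeasure π]
    {h : Θ → ℝ} {B : ℝ} (hm : Measurable h) (hb : ∀ θ, |h θ| ≤ B) :
    ∫ θ, h θ ∂π ≤ Real.log (∫ θ, Real.exp (h θ) ∂π) := by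
  have hint : Integrable (llr π π) π :=
    (integrable_congr (llr_self π)).2 (integrable_zero _ _ _)
  have := integral_sub_integral_llr_le_log_integral_exp Measure.AbsolutelyContinuous.rfl hint hm hb
  simpa [integral_congr_ae (llr_self π)] using this

/-- Comparison of the Gibbs measures with potentials `u` and `v`. -/
lemma integral_tilted_neg_le {ρ π : Measure Θ} [IsProbabilityMeasure ρ] [IsProbabilityMeasure π]
    {u v : Θ → ℝ} {A B : ℝ} (hu : Measurable u) (hub : ∀ θ, |u θ| ≤ A)
    (hv : Measurable v) (hvb : ∀ θ, |v θ| ≤ B)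
    (hac : ρ ≪ π.tilted fun θ => -v θ)
    (hint : Integrable (llr ρ (π.tilted fun θ => -v θ)) ρ) :
    ∫ θ, v θ ∂(π.tilted fun θ => -u θ) ≤
      (∫ θ, Real.exp (v θ - u θ) ∂π) / (∫ θ, Real.exp (-v θ) ∂π) - 1
        + ∫ θ, u θ ∂ρ - ∫ θ, v θ ∂ρ + ∫ θ, llr ρ (π.tilted fun θ => -v θ) θ ∂ρ := by
  have hexpu : Integrable (fun θ => Real.exp (-u θ)) π :=
    integrable_exp_of_abs_le hu.neg fun θ => by simpa using hub θ
  have hexpv : Integrable (fun θ => Real.exp (-v θ)) π :=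
    integrable_exp_of_abs_le hv.neg fun θ => by simpa using hvb θ
  have hvub : ∀ θ, |v θ - u θ| ≤ B + A := fun θ =>
    (abs_sub _ _).trans (add_le_add (hvb θ) (hub θ))
  have hexpvu : Integrable (fun θ => Real.exp (v θ - u θ)) π :=
    integrable_exp_of_abs_le (hv.sub hu) hvub
  have := isProbabilityMeasure_tilted hexpu
  have := isProbabilityMeasure_tilted hexpv
  have h1 := integral_le_log_integral_exp (π := π.tilted fun θ => -u θ) hv hvb
  have h2 := integral_sub_integral_llr_le_log_integral_exp hac hint (hv.sub hu) hvub
  rw [integral_exp_tilted] at h1 h2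
  simp only [Pi.add_apply, Pi.sub_apply, neg_add_eq_sub, sub_sub_cancel_left] at h1 h2
  have pu := integral_exp_pos hexpu
  have pv := integral_exp_pos hexpv
  have pvu := integral_exp_pos hexpvu
  rw [Real.log_div pvu.ne' pu.ne'] at h1
  rw [Real.log_div pu.ne' pv.ne', integral_sub (integrable_of_abs_le hv hvb)
    (integrable_of_abs_le hu hub)] at h2
  have h3 := Real.log_le_sub_one_of_pos (div_pos pvu pv)
  rw [Real.log_div pvu.ne' pv.ne'] at h3
  linarith

lemma tilted_add_const {π : Measure Θ} [IsProbabilityMeasure π] {h : Θ → ℝ}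
    (hexp : Integrable (fun θ => Real.exp (h θ)) π) (c : ℝ) :
    π.tilted (fun θ => h θ + c) = π.tilted h := by
  have := isProbabilityMeasure_tilted hexp
  rw [← tilted_const (π.tilted h) c, tilted_tilted hexp]
  rfl

end Variational

section ExponentialMoments

variable {Z : Type*} [MeasurableSpace Z] {P : Measure Z} [IsProbabilityMeasure P]

lemma integral_exp_neg_mul_le {g : Z → ℝ} {C t : ℝ} (hg : Measurable g) (hgb : ∀ z, |g z| ≤ C)
    (ht : 0 ≤ t) (htC : t * C ≤ 1) (hvar : t * ∫ z, g z ^ 2 ∂P ≤ (∫ z, g z ∂P) / 2) :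
    ∫ z, Real.exp (-(t * g z)) ∂P ≤ Real.exp (-(t * (∫ z, g z ∂P) / 2)) := by
  have hi : Integrable g P := integrable_of_abs_le hg hgb
  have hi2 : Integrable (fun z => g z ^ 2) P :=
    integrable_of_abs_le (B := C ^ 2) (hg.pow_const 2) fun z => by
      rw [abs_pow]; exact pow_le_pow_left₀ (abs_nonneg _) (hgb z) 2
  have hb : ∀ z, |-(t * g z)| ≤ 1 := fun z => by
    rw [abs_neg, abs_mul, abs_of_nonneg ht]
    exact (mul_le_mul_of_nonneg_left (hgb z) ht).trans htC
  have hi1 : Integrable (fun z => 1 - t * g z) P := (integrable_const _).sub (hi.const_mul t)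
  calc ∫ z, Real.exp (-(t * g z)) ∂P
      ≤ ∫ z, (1 - t * g z + t ^ 2 * g z ^ 2) ∂P := by
        refine integral_mono (integrable_exp_of_abs_le (hg.const_mul t).neg hb)
          (hi1.add (hi2.const_mul _)) fun z => ?_
        have := (abs_le.1 (Real.abs_exp_sub_one_sub_id_le (hb z))).2
        simp only
        linarith
    _ = 1 - t * (∫ z, g z ∂P) + t ^ 2 * ∫ z, g z ^ 2 ∂P := by
        rw [integral_add hi1 (hi2.const_mul _),
          integral_sub (integrable_const _) (hi.const_mul t), integral_const_mul,
          integral_const_mul]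
        simp
    _ ≤ -(t * (∫ z, g z ∂P) / 2) + 1 := by nlinarith
    _ ≤ _ := Real.add_one_le_exp _

lemma integral_pi_exp_neg_sum_le {g : Z → ℝ} {C t : ℝ} (n : ℕ) (hg : Measurable g)
    (hgb : ∀ z, |g z| ≤ C) (ht : 0 ≤ t) (htC : t * C ≤ 1)
    (hvar : t * ∫ z, g z ^ 2 ∂P ≤ (∫ z, g z ∂P) / 2) :
    ∫ ω, Real.exp (-(t * ∑ i, g (ω i))) ∂(Measure.pi fun _ : Fin n => P) ≤
      Real.exp (-(n * t * (∫ z, g z ∂P) / 2)) := by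
  have h1 : ∀ ω : Fin n → Z, Real.exp (-(t * ∑ i, g (ω i))) =
      ∏ i, Real.exp (-(t * g (ω i))) := fun ω => by
    rw [← Real.exp_sum, Finset.sum_neg_distrib, Finset.mul_sum]
  simp_rw [h1]
  rw [integral_fintype_prod_eq_pow (fun z => Real.exp (-(t * g z))), Fintype.card_fin]
  calc _ ≤ Real.exp (-(t * (∫ z, g z ∂P) / 2)) ^ n :=
        pow_le_pow_left₀ (integral_nonneg fun _ => (Real.exp_pos _).le)
          (integral_exp_neg_mul_le hg hgb ht htC hvar) n
    _ = _ := by rw [← Real.exp_nat_mul]; ring_nf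

lemma integral_pi_sum {g : Z → ℝ} (n : ℕ) (hi : Integrable g P) :
    ∫ ω, ∑ i, g (ω i) ∂(Measure.pi fun _ : Fin n => P) = n * ∫ z, g z ∂P := by
  rw [integral_finsetSum _ fun i _ => integrable_comp_eval (μ := fun _ : Fin n => P) hi]
  simp_rw [integral_comp_eval (μ := fun _ : Fin n => P) hi.aestronglyMeasurable]
  simp

end ExponentialMoments

/-- The localized bound for the excess losses `G θ`: the Gibbs average of the localizing potential
is dominated, sample by sample, by a function whose expectation is controlled. -/
lemma exists_integrable_bound_gibbs {Θ Z : Type*} [MeasurableSpace Θ] [MeasurableSpace Z]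
    {P : Measure Z} [IsProbabilityMeasure P] {π ρ : Measure Θ} [IsProbabilityMeasure π]
    [IsProbabilityMeasure ρ] {G : Θ → Z → ℝ} {C t : ℝ} (n : ℕ)
    (hG : Measurable (Function.uncurry G)) (hGb : ∀ θ z, |G θ z| ≤ C)
    (ht : 0 ≤ t) (htC : t * C ≤ 1)
    (hvar : ∀ θ, t * ∫ z, G θ z ^ 2 ∂P ≤ (∫ z, G θ z ∂P) / 2) {v : Θ → ℝ}
    (hv : ∀ θ, v θ = n * t * (∫ z, G θ z ∂P) / 4)
    (hac : ρ ≪ π.tilted fun θ => -v θ)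
    (hint : Integrable (llr ρ (π.tilted fun θ => -v θ)) ρ) :
    ∃ H : (Fin n → Z) → ℝ, Integrable H (Measure.pi fun _ => P) ∧
      (∀ ω, ∫ θ, v θ ∂(π.tilted fun θ => -(t * ∑ i, G θ (ω i))) ≤ H ω) ∧
      ∫ ω, H ω ∂(Measure.pi fun _ => P) ≤
        3 * ∫ θ, v θ ∂ρ + ∫ θ, llr ρ (π.tilted fun θ => -v θ) θ ∂ρ := by
  have hGθ : ∀ θ, Measurable (G θ) := fun θ => hG.comp measurable_prodMk_left
  have hD : Measurable fun θ => ∫ z, G θ z ∂P :=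
    hG.stronglyMeasurable.integral_prod_right.measurable
  have hvm : Measurable v := by
    rw [funext hv]
    exact (hD.const_mul _).div_const _
  have hvb : ∀ θ, |v θ| ≤ n * t * C / 4 := fun θ => by
    have := abs_integral_le_of_abs_le (μ := P) (hGb θ)
    rw [hv, abs_div, abs_mul, abs_of_nonneg (by positivity : (0 : ℝ) ≤ n * t),
      abs_of_nonneg (by norm_num : (0 : ℝ) ≤ 4)]
    gcongr
  have hum : Measurable fun p : (Fin n → Z) × Θ => t * ∑ i, G p.2 (p.1 i) := by
    refine (Finset.measurable_fun_sum _ fun i _ => ?_).const_mul t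
    exact hG.comp (measurable_snd.prodMk ((measurable_pi_apply i).comp measurable_fst))
  have hub : ∀ (ω : Fin n → Z) θ, |t * ∑ i, G θ (ω i)| ≤ t * (n * C) := fun ω θ => by
    rw [abs_mul, abs_of_nonneg ht]
    refine mul_le_mul_of_nonneg_left ((Finset.abs_sum_le_sum_abs _ _).trans ?_) ht
    exact (Finset.sum_le_sum fun i _ => hGb θ (ω i)).trans (by simp)
  have huω : ∀ ω : Fin n → Z, Measurable fun θ => t * ∑ i, G θ (ω i) := fun ω =>
    hum.comp measurable_prodMk_left
  set μ : Measure (Fin n → Z) := Measure.pi fun _ => P with hμ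
  have hF : Integrable (fun p : (Fin n → Z) × Θ => Real.exp (v p.2 - t * ∑ i, G p.2 (p.1 i)))
      (μ.prod π) :=
    integrable_exp_of_abs_le ((hvm.comp measurable_snd).sub hum) fun p =>
      (abs_sub _ _).trans (add_le_add (hvb p.2) (hub p.1 p.2))
  have hU : Integrable (fun p : (Fin n → Z) × Θ => t * ∑ i, G p.2 (p.1 i)) (μ.prod ρ) :=
    integrable_of_abs_le hum fun p => hub p.1 p.2
  have hexpv : Integrable (fun θ => Real.exp (-v θ)) π :=
    integrable_exp_of_abs_le hvm.neg fun θ => by simpa using hvb θ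
  have hc := integral_exp_pos hexpv
  have hFle : ∫ ω, ∫ θ, Real.exp (v θ - t * ∑ i, G θ (ω i)) ∂π ∂μ ≤ ∫ θ, Real.exp (-v θ) ∂π := by
    rw [integral_integral_swap (f := fun (ω : Fin n → Z) θ => Real.exp (v θ - t * ∑ i, G θ (ω i))) hF]
    refine integral_mono hF.integral_prod_right hexpv fun θ => ?_
    simp only [sub_eq_add_neg, Real.exp_add, integral_const_mul]
    calc _ ≤ Real.exp (v θ) * Real.exp (-(n * t * (∫ z, G θ z ∂P) / 2)) :=
          mul_le_mul_of_nonneg_left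
            (integral_pi_exp_neg_sum_le n (hGθ θ) (hGb θ) ht htC (hvar θ)) (Real.exp_pos _).le
      _ = _ := by rw [← Real.exp_add, hv]; ring_nf
  have hUeq : ∫ ω, ∫ θ, t * ∑ i, G θ (ω i) ∂ρ ∂μ = 4 * ∫ θ, v θ ∂ρ := by
    rw [integral_integral_swap (f := fun (ω : Fin n → Z) θ => t * ∑ i, G θ (ω i)) hU, ← integral_const_mul]
    refine integral_congr_ae (ae_of_all _ fun θ => ?_)
    simp only [integral_const_mul, hμ]
    rw [integral_pi_sum n (integrable_of_abs_le (hGθ θ) (hGb θ)), hv]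
    ring
  have hFi : Integrable (fun ω => ∫ θ, Real.exp (v θ - t * ∑ i, G θ (ω i)) ∂π) μ :=
    hF.integral_prod_left
  have hUi : Integrable (fun ω => ∫ θ, t * ∑ i, G θ (ω i) ∂ρ) μ := hU.integral_prod_left
  have hFUi : Integrable (fun ω => (∫ θ, Real.exp (v θ - t * ∑ i, G θ (ω i)) ∂π) /
      (∫ θ, Real.exp (-v θ) ∂π) + ∫ θ, t * ∑ i, G θ (ω i) ∂ρ) μ := (hFi.div_const _).add hUi
  have h1 := (div_le_one hc).2 hFle
  refine ⟨fun ω => (∫ θ, Real.exp (v θ - t * ∑ i, G θ (ω i)) ∂π) / (∫ θ, Real.exp (-v θ) ∂π)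
      + ∫ θ, t * ∑ i, G θ (ω i) ∂ρ
      + (∫ θ, llr ρ (π.tilted fun θ => -v θ) θ ∂ρ - ∫ θ, v θ ∂ρ - 1),
    hFUi.add (integrable_const _), fun ω => ?_, ?_⟩
  · have := integral_tilted_neg_le (huω ω) (hub ω) hvm hvb hac hint
    linarith
  · rw [integral_add hFUi (integrable_const _),
      integral_add (hFi.div_const _) hUi, integral_div, hUeq, integral_const]
    simp only [probReal_univ, smul_eq_mul, one_mul]
    linarith

/-- Localized oracle PAC-Bayes bound: under the Bernstein assumption with constant
`K > 0` and for `λ = n/max(2K,C)`, the Gibbs posterior satisfies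
`E_S{ E_{θ∼ρ̂_λ}[R(θ)] - R(θ*) } ≤
  inf_ρ ( 3 E_{θ∼ρ}[R(θ) - R(θ*)] + 4 max(2K,C) KL(ρ‖π_{-(λ/4)R})/n )`,
where `π_{-(λ/4)R}` has density proportional to `exp(-(λ/4) R(θ))` w.r.t. `π`. -/
theorem localized_oracle_pac_bayes_bound
    {X Y Θ : Type*} [MeasurableSpace X] [MeasurableSpace Y] [MeasurableSpace Θ]
    (P : Measure (X × Y)) [IsProbabilityMeasure P]
    (f : Θ → X → Y) (ℓ : Y → Y → ℝ) (C : ℝ) (hC : 0 < C)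
    (hmeas : Measurable (fun p : Θ × X × Y => ℓ (f p.1 p.2.1) p.2.2))
    (hbound : ∀ y' y : Y, ℓ y' y ∈ Set.Icc 0 C)
    (π : Measure Θ) [IsProbabilityMeasure π]
    (n : ℕ) (hn : 0 < n)
    (θstar : Θ) (hstar : ∀ θ, risk P f ℓ θstar ≤ risk P f ℓ θ)
    (K : ℝ) (hK : 0 < K)
    (hBernstein : ∀ θ : Θ,
      ∫ p, (ℓ (f θ p.1) p.2 - ℓ (f θstar p.1) p.2) ^ 2 ∂P ≤
        K * (risk P f ℓ θ - risk P f ℓ θstar)) :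
    (∫⁻ ω, ∫⁻ θ, ENNReal.ofReal (risk P f ℓ θ)
          ∂(gibbs π f ℓ ((n : ℝ) / max (2 * K) C) n ω)
        ∂(Measure.pi fun _ : Fin n => P))
      - ENNReal.ofReal (risk P f ℓ θstar) ≤
    ⨅ ρ : {ρ : Measure Θ // IsProbabilityMeasure ρ},
      (3 * ((∫⁻ θ, ENNReal.ofReal (risk P f ℓ θ) ∂ρ.1)
            - ENNReal.ofReal (risk P f ℓ θstar))
        + 4 * ENNReal.ofReal (max (2 * K) C)
            * KL ρ.1 (π.tilted fun θ' =>
                -((n : ℝ) / max (2 * K) C / 4) * risk P f ℓ θ') / n) := by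
  set m := max (2 * K) C
  have hm0 : 0 < m := hC.trans_le (le_max_right _ _)
  have hn0 : (0 : ℝ) < n := Nat.cast_pos.2 hn
  have hLθ : ∀ θ, Measurable fun p : X × Y => ℓ (f θ p.1) p.2 := fun θ =>
    hmeas.comp measurable_prodMk_left
  have hLb : ∀ θ (p : X × Y), |ℓ (f θ p.1) p.2| ≤ C := fun θ p =>
    abs_le.2 ⟨by linarith [(hbound (f θ p.1) p.2).1], (hbound _ _).2⟩
  have hR : Measurable (risk P f ℓ) :=
    (StronglyMeasurable.integral_prod_right (ν := P)
      (f := fun θ (p : X × Y) => ℓ (f θ p.1) p.2) hmeas.stronglyMeasurable).measurable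
  have hRb : ∀ θ, |risk P f ℓ θ| ≤ C := fun θ => abs_integral_le_of_abs_le (hLb θ)
  have hR0 : ∀ θ, 0 ≤ risk P f ℓ θ := fun θ => integral_nonneg fun p => (hbound _ _).1
  have hRint : ∀ (ν : Measure Θ) [IsProbabilityMeasure ν],
      ∫⁻ θ, ENNReal.ofReal (risk P f ℓ θ) ∂ν = ENNReal.ofReal (∫ θ, risk P f ℓ θ ∂ν) :=
    fun ν _ => (ofReal_integral_eq_lintegral_ofReal (integrable_of_abs_le hR hRb)
      (ae_of_all _ hR0)).symm
  set G : Θ → X × Y → ℝ := fun θ p => ℓ (f θ p.1) p.2 - ℓ (f θstar p.1) p.2 with hGdef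
  have hG : Measurable (Function.uncurry G) := hmeas.sub ((hLθ θstar).comp measurable_snd)
  have hGb : ∀ θ p, |G θ p| ≤ C := fun θ p => by
    have h1 := hbound (f θ p.1) p.2
    have h2 := hbound (f θstar p.1) p.2
    exact abs_le.2 ⟨by linarith [h1.1, h2.2], by linarith [h1.2, h2.1]⟩
  have hGD : ∀ θ, ∫ p, G θ p ∂P = risk P f ℓ θ - risk P f ℓ θstar := fun θ =>
    integral_sub (integrable_of_abs_le (hLθ θ) (hLb θ))
      (integrable_of_abs_le (hLθ θstar) (hLb θstar))
  set v : Θ → ℝ := fun θ => n * m⁻¹ * (∫ p, G θ p ∂P) / 4 with hvdef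
  have hvR : ∀ θ, risk P f ℓ θ = 4 * m / n * v θ + risk P f ℓ θstar := fun θ => by
    simp only [hvdef, hGD]
    field_simp
    ring
  have hvm : Measurable v := by
    simp only [hvdef, hGD]
    exact ((hR.sub_const _).const_mul _).div_const _
  have hvb : ∀ θ, |v θ| ≤ n * m⁻¹ * C / 4 := fun θ => by
    have := abs_integral_le_of_abs_le (μ := P) (hGb θ)
    simp only [hvdef]
    rw [abs_div, abs_mul, abs_of_nonneg (by positivity : (0 : ℝ) ≤ n * m⁻¹),
      abs_of_nonneg (by norm_num : (0 : ℝ) ≤ 4)]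
    gcongr
  have hRv : ∀ (ν : Measure Θ) [IsProbabilityMeasure ν],
      ∫ θ, risk P f ℓ θ ∂ν = 4 * m / n * ∫ θ, v θ ∂ν + risk P f ℓ θstar := fun ν _ => by
    rw [integral_congr_ae (ae_of_all _ hvR), integral_add
      ((integrable_of_abs_le hvm hvb).const_mul _) (integrable_const _), integral_const_mul]
    simp
  have hvar : ∀ θ, m⁻¹ * ∫ p, G θ p ^ 2 ∂P ≤ (∫ p, G θ p ∂P) / 2 := fun θ => by
    have h1 : m⁻¹ * (K * (risk P f ℓ θ - risk P f ℓ θstar)) ≤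
        (risk P f ℓ θ - risk P f ℓ θstar) / 2 := by
      rw [inv_mul_le_iff₀ hm0]
      nlinarith [hstar θ, le_max_left (2 * K) C]
    rw [hGD]
    exact (mul_le_mul_of_nonneg_left (hBernstein θ) (inv_pos.2 hm0).le).trans h1
  have hprior : (π.tilted fun θ => -((n : ℝ) / m / 4) * risk P f ℓ θ) =
      π.tilted fun θ => -v θ := by
    rw [← tilted_add_const (integrable_exp_of_abs_le (h := fun θ => -v θ) hvm.neg fun θ => by simpa using hvb θ)
      (-((n : ℝ) / m / 4) * risk P f ℓ θstar)]
    congr 1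
    funext θ
    simp only [hvdef, hGD]
    ring
  have hum : ∀ ω : Fin n → X × Y, Measurable fun θ => -(m⁻¹ * ∑ i, G θ (ω i)) := fun ω =>
    ((Finset.measurable_fun_sum _ fun i _ => hG.comp measurable_prodMk_right).const_mul _).neg
  have hub : ∀ (ω : Fin n → X × Y) θ, |-(m⁻¹ * ∑ i, G θ (ω i))| ≤ m⁻¹ * (n * C) := fun ω θ => by
    rw [abs_neg, abs_mul, abs_of_pos (inv_pos.2 hm0)]
    refine mul_le_mul_of_nonneg_left ((Finset.abs_sum_le_sum_abs _ _).trans ?_)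
      (inv_pos.2 hm0).le
    exact (Finset.sum_le_sum fun i _ => hGb θ (ω i)).trans (by simp)
  have hgibbs : ∀ ω : Fin n → X × Y, gibbs π f ℓ ((n : ℝ) / m) n ω =
      π.tilted fun θ => -(m⁻¹ * ∑ i, G θ (ω i)) := fun ω => by
    rw [gibbs, ← tilted_add_const (integrable_exp_of_abs_le (hum ω) (hub ω))
      (-((n : ℝ) / m) * empRisk f ℓ n ω θstar)]
    congr 1
    funext θ
    simp only [hGdef, empRisk, Finset.sum_sub_distrib]
    field_simp
    ring
  refine le_iInf fun ⟨ρ, hρ⟩ => ?_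
  simp only
  rw [hprior]
  by_cases hKL : ρ ≪ (π.tilted fun θ => -v θ) ∧
      Integrable (llr ρ (π.tilted fun θ => -v θ)) ρ
  swap
  · have htop : KL ρ (π.tilted fun θ => -v θ) = ⊤ := if_neg hKL
    rw [htop, ENNReal.mul_top (by simp [hm0]), ENNReal.top_div_of_ne_top (by simp), add_top]
    exact le_top
  have hKLeq : KL ρ (π.tilted fun θ => -v θ) =
      ENNReal.ofReal (∫ θ, llr ρ (π.tilted fun θ => -v θ) θ ∂ρ) := if_pos hKL
  obtain ⟨H, hHi, hle, hH⟩ := exists_integrable_bound_gibbs n hG hGb (inv_pos.2 hm0).le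
    ((inv_mul_le_iff₀ hm0).2 (by rw [mul_one]; exact le_max_right _ _)) hvar (fun _ => rfl)
    hKL.1 hKL.2
  have hc : 0 ≤ 4 * m / n := by positivity
  have hgp : ∀ ω : Fin n → X × Y,
      IsProbabilityMeasure (π.tilted fun θ => -(m⁻¹ * ∑ i, G θ (ω i))) := fun ω =>
    isProbabilityMeasure_tilted (integrable_exp_of_abs_le (hum ω) (hub ω))
  have hpt : ∀ ω : Fin n → X × Y,
      ∫ θ, risk P f ℓ θ ∂(π.tilted fun θ => -(m⁻¹ * ∑ i, G θ (ω i))) ≤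
        4 * m / n * H ω + risk P f ℓ θstar := fun ω => by
    have := hgp ω
    rw [hRv]
    gcongr
    exact hle ω
  have hbound_lintegral :
      ∫⁻ ω, ∫⁻ θ, ENNReal.ofReal (risk P f ℓ θ) ∂(gibbs π f ℓ ((n : ℝ) / m) n ω)
        ∂(Measure.pi fun _ : Fin n => P) ≤
      ENNReal.ofReal (4 * m / n * (3 * ∫ θ, v θ ∂ρ +
        ∫ θ, llr ρ (π.tilted fun θ => -v θ) θ ∂ρ) + risk P f ℓ θstar) := by
    calc _ ≤ ∫⁻ ω, ENNReal.ofReal (4 * m / n * H ω + risk P f ℓ θstar)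
          ∂(Measure.pi fun _ : Fin n => P) := lintegral_mono fun ω => by
            have := hgp ω
            simp only
            rw [hgibbs, hRint]
            exact ENNReal.ofReal_le_ofReal (hpt ω)
      _ = ENNReal.ofReal (∫ ω, (4 * m / n * H ω + risk P f ℓ θstar)
          ∂(Measure.pi fun _ : Fin n => P)) :=
          (ofReal_integral_eq_lintegral_ofReal ((hHi.const_mul _).add (integrable_const _))
            (ae_of_all _ fun ω => (integral_nonneg hR0).trans (hpt ω))).symm
      _ ≤ _ := by
          rw [integral_add (hHi.const_mul _) (integrable_const _), integral_const_mul]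
          simp only [integral_const, probReal_univ, one_smul]
          gcongr
  rw [tsub_le_iff_right, hRint, hKLeq, ← ENNReal.ofReal_sub _ (hR0 _), hRv ρ]
  refine hbound_lintegral.trans (ENNReal.ofReal_add_le.trans (add_le_add_left ?_ _))
  have h3 : (3 : ℝ≥0∞) = ENNReal.ofReal 3 := by simp
  have h4 : (4 : ℝ≥0∞) = ENNReal.ofReal 4 := by simp
  have hnE : (n : ℝ≥0∞) = ENNReal.ofReal n := by simp
  rw [h3, h4, hnE, ← ENNReal.ofReal_mul (by norm_num), ← ENNReal.ofReal_mul (by norm_num),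
    ← ENNReal.ofReal_mul (by positivity), ← ENNReal.ofReal_div_of_pos hn0]
  refine le_trans (ENNReal.ofReal_le_ofReal (le_of_eq ?_)) ENNReal.ofReal_add_le
  ring
end

section
/- Log-free oracle rate from localization: assume the Bernstein assumption holds with constant K > 0 (for every θ ∈ Θ, E_{(X,Y)∼P}[ (ℓ(f_θ(X),Y) − ℓ(f_{θ*}(X),Y))² ] ≤ K ( R(θ) − R(θ*) ), where R(θ*) = min_θ R(θ)), that the π-dimension d_π = sup over β ≥ 0 of β · E_{θ∼π_{−βR}}[R(θ) − R(θ*)] is finite, where π_{−βR} has density proportional to exp(−β R(θ)) with respect to π, and take λ = n / max(2K, C). Then the Gibbs posterior ρ̂_λ with density proportional to exp(−λ r(θ)) with respect to π satisfies E_S E_{θ∼ρ̂_λ}[R(θ)] ≤ R(θ*) + 12 d_π max(2K, C) / n. -/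
open MeasureTheory
open scoped ENNReal

open Real in
/-- Two applications of Jensen's inequality, to `ν` and to its tilting by `a`. -/
lemma one_add_integral_tilted_add_integral_le {Θ : Type*} [MeasurableSpace Θ]
    (ν : Measure Θ) [IsProbabilityMeasure ν] {a b : Θ → ℝ}
    (ha : Integrable a ν) (hea : Integrable (fun θ => exp (a θ)) ν)
    (hb : Integrable b (ν.tilted a)) (heb : Integrable (fun θ => exp (b θ)) (ν.tilted a)) :
    1 + (∫ θ, b θ ∂(ν.tilted a)) + ∫ θ, a θ ∂ν ≤ ∫ θ, exp (a θ + b θ) ∂ν := by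
  have := isProbabilityMeasure_tilted hea
  have h1 : exp (∫ θ, a θ ∂ν) ≤ ∫ θ, exp (a θ) ∂ν :=
    convexOn_exp.map_integral_le continuous_exp.continuousOn isClosed_univ (by simp) ha hea
  have h2 : exp (∫ θ, b θ ∂(ν.tilted a)) ≤ ∫ θ, exp (b θ) ∂(ν.tilted a) :=
    convexOn_exp.map_integral_le continuous_exp.continuousOn isClosed_univ (by simp) hb heb
  have hpos := integral_exp_pos hea
  rw [integral_exp_tilted, le_div_iff₀ hpos] at h2
  simp only [Pi.add_apply] at h2
  have h3 := add_one_le_exp ((∫ θ, b θ ∂(ν.tilted a)) + ∫ θ, a θ ∂ν)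
  rw [exp_add] at h3
  have h4 := mul_le_mul_of_nonneg_left h1 (exp_pos (∫ θ, b θ ∂(ν.tilted a))).le
  linarith

lemma integrable_of_measurable_of_abs_le {Z : Type*} [MeasurableSpace Z] {μ : Measure Z}
    [IsFiniteMeasure μ] {h : Z → ℝ} {B : ℝ} (hh : Measurable h) (hB : ∀ z, |h z| ≤ B) :
    Integrable h μ :=
  .of_bound hh.aestronglyMeasurable B (.of_forall hB)

lemma integrable_exp_of_measurable_of_abs_le {Z : Type*} [MeasurableSpace Z] {μ : Measure Z}
    [IsFiniteMeasure μ] {h : Z → ℝ} {B : ℝ} (hh : Measurable h) (hB : ∀ z, |h z| ≤ B) :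
    Integrable (fun z => Real.exp (h z)) μ :=
  integrable_of_measurable_of_abs_le (B := Real.exp B) hh.exp fun z => by
    rw [Real.abs_exp]
    exact Real.exp_le_exp.2 (le_of_abs_le (hB z))

open Real in
/-- Under a Bernstein condition, the exponential moment at inverse temperature `1 / M` contracts. -/
lemma integral_exp_neg_div_le_of_bernstein {Z : Type*} [MeasurableSpace Z] (P : Measure Z)
    [IsProbabilityMeasure P] {h : Z → ℝ} {K M : ℝ} (hM : 0 < M) (hK : 2 * K ≤ M)
    (hh : Measurable h) (hhM : ∀ z, |h z| ≤ M) (hnonneg : 0 ≤ ∫ z, h z ∂P)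
    (hB : ∫ z, h z ^ 2 ∂P ≤ K * ∫ z, h z ∂P) :
    ∫ z, exp (-(h z / M)) ∂P ≤ exp (-((∫ z, h z ∂P) / (2 * M))) := by
  have hi : Integrable h P := integrable_of_measurable_of_abs_le hh hhM
  have hi2 : Integrable (fun z => h z ^ 2) P :=
    integrable_of_measurable_of_abs_le (B := M ^ 2) (hh.pow_const 2) fun z => by
      rw [abs_pow]
      exact pow_le_pow_left₀ (abs_nonneg _) (hhM z) 2
  have habs (z : Z) : |-(h z / M)| ≤ 1 := by
    rw [abs_neg, abs_div, abs_of_pos hM, div_le_one hM]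
    exact hhM z
  have hpt (z : Z) : exp (-(h z / M)) ≤ 1 - h z / M + h z ^ 2 / M ^ 2 := by
    have := le_of_abs_le (abs_exp_sub_one_sub_id_le (habs z))
    rw [neg_sq, div_pow] at this
    linarith
  have hlin : Integrable (fun z => 1 - h z / M) P := (integrable_const 1).sub (hi.div_const M)
  calc ∫ z, exp (-(h z / M)) ∂P
      ≤ ∫ z, (1 - h z / M + h z ^ 2 / M ^ 2) ∂P :=
        integral_mono (integrable_exp_of_measurable_of_abs_le (hh.div_const M).neg habs)
          (hlin.add (hi2.div_const _)) hpt
    _ = 1 - (∫ z, h z ∂P) / M + (∫ z, h z ^ 2 ∂P) / M ^ 2 := by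
        rw [integral_add hlin (hi2.div_const _),
          integral_sub (integrable_const 1) (hi.div_const M), integral_div, integral_div]
        simp
    _ ≤ 1 - (∫ z, h z ∂P) / M + (M / 2 * ∫ z, h z ∂P) / M ^ 2 := by
        gcongr
        exact hB.trans (mul_le_mul_of_nonneg_right (by linarith) hnonneg)
    _ = -((∫ z, h z ∂P) / (2 * M)) + 1 := by
        field_simp
        ring
    _ ≤ _ := add_one_le_exp _

open Real in
lemma integral_exp_sum_add_le_one_of_bernstein {Z : Type*} [MeasurableSpace Z] (P : Measure Z)
    [IsProbabilityMeasure P] {h : Z → ℝ} {K M : ℝ} (hM : 0 < M) (hK : 2 * K ≤ M)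
    (hh : Measurable h) (hhM : ∀ z, |h z| ≤ M) (hnonneg : 0 ≤ ∫ z, h z ∂P)
    (hB : ∫ z, h z ^ 2 ∂P ≤ K * ∫ z, h z ∂P) (n : ℕ) :
    ∫ ω, exp (-((∑ i, h (ω i)) / M) + n * ((∫ z, h z ∂P) / (2 * M)))
      ∂(Measure.pi fun _ : Fin n => P) ≤ 1 := by
  have heq (ω : Fin n → Z) : exp (-((∑ i, h (ω i)) / M) + n * ((∫ z, h z ∂P) / (2 * M))) =
      (∏ i, exp (-(h (ω i) / M))) * exp (n * ((∫ z, h z ∂P) / (2 * M))) := by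
    rw [exp_add, ← exp_sum, Finset.sum_neg_distrib, Finset.sum_div]
  simp_rw [heq]
  rw [integral_mul_const,
    integral_fintype_prod_eq_pow (ι := Fin n) (μ := P) (fun z => exp (-(h z / M))),
    Fintype.card_fin]
  have hle := pow_le_pow_left₀ (integral_nonneg fun z => (exp_pos (-(h z / M))).le)
    (integral_exp_neg_div_le_of_bernstein P hM hK hh hhM hnonneg hB) n
  calc _ ≤ exp (-((∫ z, h z ∂P) / (2 * M))) ^ n * exp (n * ((∫ z, h z ∂P) / (2 * M))) := by
        gcongr
    _ = 1 := by
        rw [← exp_nat_mul, ← exp_add, mul_neg, neg_add_cancel, exp_zero]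

lemma abs_integral_le_of_forall_mem_Icc {Z : Type*} [MeasurableSpace Z] (P : Measure Z)
    [IsProbabilityMeasure P] {g : Z → ℝ} {C : ℝ} (hg : ∀ z, g z ∈ Set.Icc 0 C) :
    |∫ z, g z ∂P| ≤ C := by
  have := norm_integral_le_of_norm_le_const (μ := P) (f := g) (C := C)
    (.of_forall fun z => by rw [Real.norm_of_nonneg (hg z).1]; exact (hg z).2)
  simpa using this

lemma abs_sum_div_le_of_forall_mem_Icc {Z : Type*} {g : Z → ℝ} {C : ℝ}
    (hg : ∀ z, g z ∈ Set.Icc 0 C) {n : ℕ} (hn : 0 < n) (ω : Fin n → Z) :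
    |(∑ i, g (ω i)) / n| ≤ C := by
  have hn' : (0 : ℝ) < n := Nat.cast_pos.2 hn
  rw [abs_of_nonneg (div_nonneg (Finset.sum_nonneg fun i _ => (hg _).1) hn'.le), div_le_iff₀ hn']
  calc _ ≤ ∑ _i : Fin n, C := Finset.sum_le_sum fun i _ => (hg _).2
    _ = C * n := by simp [mul_comm]

lemma integral_pi_sum_div {Z : Type*} [MeasurableSpace Z] (P : Measure Z)
    [IsProbabilityMeasure P] {g : Z → ℝ} (hg : Integrable g P) {n : ℕ} (hn : 0 < n) :
    ∫ ω, (∑ i, g (ω i)) / n ∂(Measure.pi fun _ : Fin n => P) = ∫ z, g z ∂P := by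
  have hn' : (n : ℝ) ≠ 0 := Nat.cast_ne_zero.2 hn.ne'
  rw [integral_div, integral_finsetSum _ fun i _ => integrable_comp_eval hg]
  simp_rw [integral_comp_eval (μ := fun _ : Fin n => P) hg.aestronglyMeasurable]
  simp [hn']

open Real in
lemma stronglyMeasurable_integral_tilted {Ω Θ : Type*} [MeasurableSpace Ω] [MeasurableSpace Θ]
    (ν : Measure Θ) [SFinite ν] {a : Ω → Θ → ℝ} {b : Θ → ℝ}
    (ha : Measurable (Function.uncurry a)) (hb : Measurable b) :
    StronglyMeasurable fun ω => ∫ θ, b θ ∂(ν.tilted (a ω)) := by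
  simp_rw [integral_tilted]
  have hden : Measurable fun ω => ∫ θ, exp (a ω θ) ∂ν :=
    (StronglyMeasurable.integral_prod_right (f := fun ω θ => exp (a ω θ))
      ha.exp.stronglyMeasurable).measurable
  refine StronglyMeasurable.integral_prod_right
    (f := fun ω θ => (exp (a ω θ) / ∫ x, exp (a ω x) ∂ν) • b θ) ?_
  exact ((ha.exp.div (hden.comp measurable_fst)).smul
    (hb.comp measurable_snd)).stronglyMeasurable

open Real in
/-- The expected risk of a Gibbs posterior is controlled by three times the expected excess risk
under the Gibbs measure of the true risk at a quarter of the inverse temperature. -/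
lemma integral_integral_tilted_le_of_bernstein {Z Θ : Type*} [MeasurableSpace Z]
    [MeasurableSpace Θ] (P : Measure Z) [IsProbabilityMeasure P] {g : Θ → Z → ℝ} {C K M : ℝ}
    (hg : Measurable (Function.uncurry g)) (hgC : ∀ θ z, g θ z ∈ Set.Icc 0 C)
    (μ₀ : Measure Θ) [IsProbabilityMeasure μ₀] {n : ℕ} (hn : 0 < n) (θs : Θ)
    (hstar : ∀ θ, ∫ z, g θs z ∂P ≤ ∫ z, g θ z ∂P) (hM : 0 < M) (hK : 2 * K ≤ M) (hCM : C ≤ M)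
    (hB : ∀ θ, ∫ z, (g θ z - g θs z) ^ 2 ∂P ≤ K * ((∫ z, g θ z ∂P) - ∫ z, g θs z ∂P)) :
    ∫ ω, (∫ θ, (∫ z, g θ z ∂P) ∂(μ₀.tilted fun θ => -(n / M) * ((∑ i, g θ (ω i)) / n)))
        ∂(Measure.pi fun _ : Fin n => P) ≤
      (∫ z, g θs z ∂P) + 3 * ∫ θ, ((∫ z, g θ z ∂P) - ∫ z, g θs z ∂P)
        ∂(μ₀.tilted fun θ => -(n / M / 4) * ∫ z, g θ z ∂P) := by
  set Q := Measure.pi fun _ : Fin n => P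
  set R : Θ → ℝ := fun θ => ∫ z, g θ z ∂P
  set r : (Fin n → Z) → Θ → ℝ := fun ω θ => (∑ i, g θ (ω i)) / n with hr
  set lam : ℝ := n / M with hlam
  change ∫ ω, (∫ θ, R θ ∂(μ₀.tilted fun θ => -lam * r ω θ)) ∂Q ≤
    R θs + 3 * ∫ θ, (R θ - R θs) ∂(μ₀.tilted fun θ => -(lam / 4) * R θ)
  have hn' : (0 : ℝ) < n := Nat.cast_pos.2 hn
  have hlam0 : 0 < lam := div_pos hn' hM
  have hgθ (θ : Θ) : Measurable (g θ) := hg.comp measurable_prodMk_left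
  have hgi (θ : Θ) : Integrable (g θ) P :=
    integrable_of_measurable_of_abs_le (B := C) (hgθ θ) fun z => by
      rw [abs_of_nonneg (hgC θ z).1]
      exact (hgC θ z).2
  have hRm : Measurable R := (hg.stronglyMeasurable.integral_prod_right (ν := P)).measurable
  have hrm : Measurable (Function.uncurry r) := by
    refine (Finset.measurable_sum _ fun i _ => ?_).div_const _
    exact hg.comp (measurable_snd.prodMk ((measurable_pi_apply i).comp measurable_fst))
  have hrω (ω : Fin n → Z) : Measurable (r ω) := hrm.comp measurable_prodMk_left
  have hRC (θ : Θ) : |R θ| ≤ C := abs_integral_le_of_forall_mem_Icc P (hgC θ)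
  have hrC (ω : Fin n → Z) (θ : Θ) : |r ω θ| ≤ C :=
    abs_sum_div_le_of_forall_mem_Icc (hgC θ) hn ω
  have hRint (μ : Measure Θ) [IsFiniteMeasure μ] : Integrable R μ :=
    integrable_of_measurable_of_abs_le hRm hRC
  have hscale {x : ℝ} (hx : |x| ≤ C) (c : ℝ) : |c * x| ≤ |c| * C := by
    rw [abs_mul]
    gcongr
  set ν := μ₀.tilted fun θ => -(lam / 4) * R θ
  have hexpR : Integrable (fun θ => exp (-(lam / 4) * R θ)) μ₀ :=
    integrable_exp_of_measurable_of_abs_le (hRm.const_mul _) fun θ => hscale (hRC θ) _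
  have : IsProbabilityMeasure ν := isProbabilityMeasure_tilted hexpR
  set a : (Fin n → Z) → Θ → ℝ := fun ω θ => -lam * r ω θ + lam / 4 * R θ with ha
  set b : (Fin n → Z) → Θ → ℝ :=
    fun ω θ => lam / 4 * R θ + (lam * r ω θs - lam / 2 * R θs) with hb
  have htilt (ω : Fin n → Z) : (μ₀.tilted fun θ => -lam * r ω θ) = ν.tilted (a ω) := by
    rw [tilted_tilted hexpR]
    congr 1
    ext θ
    simp only [ha, Pi.add_apply]
    ring
  have ham : Measurable (Function.uncurry a) :=
    (hrm.const_mul (-lam)).add ((hRm.comp measurable_snd).const_mul (lam / 4))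
  have haω (ω : Fin n → Z) : Measurable (a ω) := ham.comp measurable_prodMk_left
  have haB (ω : Fin n → Z) (θ : Θ) : |a ω θ| ≤ |-lam| * C + |lam / 4| * C :=
    (abs_add_le _ _).trans (add_le_add (hscale (hrC ω θ) _) (hscale (hRC θ) _))
  have hbm : Measurable (Function.uncurry b) :=
    ((hRm.comp measurable_snd).const_mul (lam / 4)).add
      ((((hrm.comp measurable_prodMk_right).comp measurable_fst).const_mul lam).sub
        measurable_const)
  have hbω (ω : Fin n → Z) : Measurable (b ω) := hbm.comp measurable_prodMk_left
  have hbB (ω : Fin n → Z) (θ : Θ) :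
      |b ω θ| ≤ |lam / 4| * C + (|lam| * C + |lam / 2| * C) :=
    (abs_add_le _ _).trans (add_le_add (hscale (hRC θ) _)
      ((abs_sub _ _).trans (add_le_add (hscale (hrC ω θs) _) (hscale (hRC θs) _))))
  have hprob (ω : Fin n → Z) : IsProbabilityMeasure (ν.tilted (a ω)) :=
    isProbabilityMeasure_tilted (integrable_exp_of_measurable_of_abs_le (haω ω) (haB ω))
  have hprod : Integrable (Function.uncurry fun ω θ => exp (a ω θ + b ω θ)) (Q.prod ν) :=
    integrable_exp_of_measurable_of_abs_le (ham.add hbm) fun p =>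
      (abs_add_le _ _).trans (add_le_add (haB p.1 p.2) (hbB p.1 p.2))
  have haprod : Integrable (Function.uncurry a) (Q.prod ν) :=
    integrable_of_measurable_of_abs_le ham fun p => haB p.1 p.2
  set G : (Fin n → Z) → ℝ := fun ω => ∫ θ, R θ ∂(ν.tilted (a ω))
  have hpt (ω : Fin n → Z) :
      1 + (lam / 4 * G ω + (lam * r ω θs - lam / 2 * R θs)) + ∫ θ, a ω θ ∂ν ≤
        ∫ θ, exp (a ω θ + b ω θ) ∂ν := by
    have := one_add_integral_tilted_add_integral_le ν
      (integrable_of_measurable_of_abs_le (haω ω) (haB ω))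
      (integrable_exp_of_measurable_of_abs_le (haω ω) (haB ω))
      (integrable_of_measurable_of_abs_le (hbω ω) (hbB ω))
      (integrable_exp_of_measurable_of_abs_le (hbω ω) (hbB ω))
    rwa [integral_add ((hRint _).const_mul _) (integrable_const _), integral_const_mul,
      integral_const, probReal_univ, one_smul] at this
  have hGi : Integrable G Q := by
    refine integrable_of_measurable_of_abs_le (B := C)
      (stronglyMeasurable_integral_tilted ν ham hRm).measurable fun ω => ?_
    simpa using norm_integral_le_of_norm_le_const (μ := ν.tilted (a ω)) (f := R) (C := C)
      (.of_forall hRC)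
  have hri (θ : Θ) : Integrable (fun ω => r ω θ) Q :=
    integrable_of_measurable_of_abs_le (hrm.comp measurable_prodMk_right) fun ω => hrC ω θ
  have hrint (θ : Θ) : ∫ ω, r ω θ ∂Q = R θ := integral_pi_sum_div P (hgi θ) hn
  have hmoment : ∫ ω, (∫ θ, exp (a ω θ + b ω θ) ∂ν) ∂Q ≤ 1 := by
    rw [integral_integral_swap hprod]
    have hle (θ : Θ) : ∫ ω, exp (a ω θ + b ω θ) ∂Q ≤ 1 := by
      have hsub : ∫ z, (g θ z - g θs z) ∂P = R θ - R θs := integral_sub (hgi θ) (hgi θs)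
      have := integral_exp_sum_add_le_one_of_bernstein P (h := fun z => g θ z - g θs z) hM hK
        ((hgθ θ).sub (hgθ θs))
        (fun z => (abs_sub_le_of_nonneg_of_le (hgC θ z).1 (hgC θ z).2 (hgC θs z).1
          (hgC θs z).2).trans hCM)
        (by rw [hsub]; exact sub_nonneg.2 (hstar θ)) (by rw [hsub]; exact hB θ) n
      refine le_of_eq_of_le (integral_congr_ae (.of_forall fun ω => ?_)) this
      simp only [hsub, ha, hb, hr, Finset.sum_sub_distrib, hlam]
      congr 1
      field_simp
      ring
    calc _ ≤ ∫ _θ, (1 : ℝ) ∂ν :=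
          integral_mono hprod.integral_prod_right (integrable_const 1) hle
      _ = 1 := by simp
  have haint : ∫ ω, (∫ θ, a ω θ ∂ν) ∂Q = -(3 * lam / 4) * ∫ θ, R θ ∂ν := by
    rw [integral_integral_swap haprod, ← integral_const_mul]
    congr 1 with θ
    simp only [ha]
    rw [integral_add ((hri θ).const_mul _) (integrable_const _), integral_const_mul, hrint,
      integral_const, probReal_univ, one_smul]
    ring
  have hi1 : Integrable (fun ω => lam * r ω θs - lam / 2 * R θs) Q :=
    ((hri θs).const_mul lam).sub (integrable_const _)
  have hi2 := (hGi.const_mul (lam / 4)).add hi1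
  have hi3 := (integrable_const (1 : ℝ)).add hi2
  have hkey := (integral_mono (hi3.add haprod.integral_prod_left) hprod.integral_prod_left
    hpt).trans hmoment
  rw [integral_add' hi3 haprod.integral_prod_left, integral_add' (integrable_const _) hi2,
    integral_add' (hGi.const_mul _) hi1, integral_sub ((hri θs).const_mul lam)
    (integrable_const _), integral_const_mul, integral_const_mul, hrint] at hkey
  simp only [Function.uncurry_apply_pair] at hkey
  rw [haint] at hkey
  simp only [integral_const, probReal_univ, one_smul] at hkey
  simp_rw [htilt]
  rw [integral_sub (hRint ν) (integrable_const _), integral_const, probReal_univ, one_smul]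
  change ∫ ω, G ω ∂Q ≤ _
  have : lam / 4 * ∫ ω, G ω ∂Q ≤ lam / 4 * (R θs + 3 * ((∫ θ, R θ ∂ν) - R θs)) := by
    linarith
  exact le_of_mul_le_mul_left this (by positivity)

/-- Log-free oracle rate from localization: under the Bernstein assumption with constant
`K > 0`, finiteness of the `π`-dimension `d_π` (expressed as: `d` is the least upper
bound of `{β E_{θ∼π_{-βR}}[R(θ) - R(θ*)] : β ≥ 0}`), and for `λ = n/max(2K,C)`,
`E_S E_{θ∼ρ̂_λ}[R(θ)] ≤ R(θ*) + 12 d_π max(2K,C)/n`. -/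
theorem log_free_oracle_rate_from_localization
    {X Y Θ : Type*} [MeasurableSpace X] [MeasurableSpace Y] [MeasurableSpace Θ]
    (P : Measure (X × Y)) [IsProbabilityMeasure P]
    (f : Θ → X → Y) (ℓ : Y → Y → ℝ) (C : ℝ) (hC : 0 < C)
    (hmeas : Measurable (fun p : Θ × X × Y => ℓ (f p.1 p.2.1) p.2.2))
    (hbound : ∀ y' y : Y, ℓ y' y ∈ Set.Icc 0 C)
    (π : Measure Θ) [IsProbabilityMeasure π]
    (n : ℕ) (hn : 0 < n)
    (θstar : Θ) (hstar : ∀ θ, risk P f ℓ θstar ≤ risk P f ℓ θ)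
    (K : ℝ) (hK : 0 < K)
    (hBernstein : ∀ θ : Θ,
      ∫ p, (ℓ (f θ p.1) p.2 - ℓ (f θstar p.1) p.2) ^ 2 ∂P ≤
        K * (risk P f ℓ θ - risk P f ℓ θstar))
    (d : ℝ)
    (hlub : IsLUB {x : ℝ | ∃ β : ℝ, 0 ≤ β ∧
      x = β * ∫ θ, (risk P f ℓ θ - risk P f ℓ θstar)
        ∂(π.tilted fun θ' => -β * risk P f ℓ θ')} d) :
    ∫ ω, (∫ θ, risk P f ℓ θ ∂(gibbs π f ℓ ((n : ℝ) / max (2 * K) C) n ω))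
        ∂(Measure.pi fun _ : Fin n => P) ≤
      risk P f ℓ θstar + 12 * d * max (2 * K) C / n := by
  have hM : 0 < max (2 * K) C := lt_max_of_lt_right hC
  have hn' : (0 : ℝ) < n := Nat.cast_pos.2 hn
  have hmain := integral_integral_tilted_le_of_bernstein P
    (g := fun θ p => ℓ (f θ p.1) p.2) hmeas (fun _ _ => hbound _ _) π hn θstar hstar hM
    (le_max_left _ _) (le_max_right _ _) hBernstein
  have hd := hlub.1 ⟨(n : ℝ) / max (2 * K) C / 4, by positivity, rfl⟩
  refine hmain.trans (add_le_add le_rfl ?_)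
  calc _ = 12 * max (2 * K) C / n * (n / max (2 * K) C / 4 *
        ∫ θ, (risk P f ℓ θ - risk P f ℓ θstar)
          ∂(π.tilted fun θ' => -(n / max (2 * K) C / 4) * risk P f ℓ θ')) := by
        simp only [risk]
        field_simp
        ring
    _ ≤ 12 * max (2 * K) C / n * d := mul_le_mul_of_nonneg_left hd (by positivity)
    _ = _ := by ring
end

section
/- PAC bound for a finite class and the empirical risk minimizer: assume Θ is finite with card(Θ) = M. For any ε ∈ (0,1), with probability at least 1 − ε over the i.i.d. sample S, simultaneously for all θ ∈ Θ: R(θ) ≤ r(θ) + C √( log(M/ε) / (2n) ). Consequently, any empirical risk minimizer θ̂_ERM ∈ argmin_{θ∈Θ} r(θ) satisfies, with probability at least 1 − ε, R(θ̂_ERM) ≤ inf over θ ∈ Θ of ( r(θ) + C √( log(M/ε) / (2n) ) ). -/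
open MeasureTheory
open scoped ENNReal

/-- **Hoeffding's inequality** for the lower tail of the empirical mean of a bounded function of
an i.i.d. sample. -/
theorem measureReal_pi_mean_add_lt_integral_le {Z : Type*} [MeasurableSpace Z]
    (P : Measure Z) [IsProbabilityMeasure P] {g : Z → ℝ} (hg : Measurable g) {C : ℝ}
    (hC : 0 < C) (hgC : ∀ z, g z ∈ Set.Icc 0 C) {n : ℕ} (hn : 0 < n) {t : ℝ} (ht : 0 ≤ t) :
    (Measure.pi fun _ : Fin n => P).real {ω | (∑ i, g (ω i)) / n + t < ∫ z, g z ∂P} ≤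
      Real.exp (-(2 * n * t ^ 2 / C ^ 2)) := by
  have hn' : (0 : ℝ) < n := Nat.cast_pos.mpr hn
  have hsub : ProbabilityTheory.HasSubgaussianMGF (-fun z => g z - ∫ z, g z ∂P)
      ((‖C - 0‖₊ / 2) ^ 2) P :=
    (ProbabilityTheory.hasSubgaussianMGF_of_mem_Icc hg.aemeasurable (ae_of_all _ hgC)).neg
  have hsub' (i : Fin n) : ProbabilityTheory.HasSubgaussianMGF
      (fun ω : Fin n → Z => (-fun z => g z - ∫ z, g z ∂P) (ω i)) ((‖C - 0‖₊ / 2) ^ 2)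
      (Measure.pi fun _ : Fin n => P) := by
    refine ProbabilityTheory.HasSubgaussianMGF.of_map (Y := Function.eval i)
      (measurable_pi_apply i).aemeasurable ?_
    rwa [(measurePreserving_eval (fun _ : Fin n => P) i).map_eq]
  have hindep := ProbabilityTheory.iIndepFun_pi (μ := fun _ : Fin n => P)
    (X := fun _ => -fun z => g z - ∫ z, g z ∂P) fun _ => (hg.sub_const _).neg.aemeasurable
  have key := ProbabilityTheory.HasSubgaussianMGF.measure_sum_ge_le_of_iIndepFun hindep
    (s := Finset.univ) (fun i _ => hsub' i) (mul_nonneg hn'.le ht)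
  refine (measureReal_mono fun ω hω => ?_).trans (key.trans_eq ?_)
  · simp only [Set.mem_ofPred_eq] at hω ⊢
    have hlt : (∑ i, g (ω i)) + t * n < (∫ z, g z ∂P) * n := by
      have := mul_lt_mul_of_pos_right hω hn'
      rwa [add_mul, div_mul_cancel₀ _ hn'.ne'] at this
    simp only [Pi.neg_apply, neg_sub, Finset.sum_sub_distrib, Finset.sum_const,
      Finset.card_univ, Fintype.card_fin, nsmul_eq_mul]
    linarith
  · congr 1
    simp only [sub_zero, Finset.sum_const, Finset.card_univ, Fintype.card_fin, nsmul_eq_mul]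
    push_cast
    rw [Real.norm_of_nonneg hC.le]
    field_simp

/-- The union bound over a finite family, in terms of the probability of the good event. -/
theorem ofReal_one_sub_le_measure_setOf_forall {Ω ι : Type*} [MeasurableSpace Ω] [Fintype ι]
    (μ : Measure Ω) [IsProbabilityMeasure μ] (p : ι → Ω → Prop) {ε : ℝ}
    (h : ∀ i, μ.real {ω | ¬ p i ω} ≤ ε / Fintype.card ι) (hε : 0 ≤ ε) :
    ENNReal.ofReal (1 - ε) ≤ μ {ω | ∀ i, p i ω} := by
  have hbad : μ.real {ω | ∀ i, p i ω}ᶜ ≤ ε := by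
    have hset : {ω | ∀ i, p i ω}ᶜ = ⋃ i, {ω | ¬ p i ω} := by
      ext ω
      simp
    rw [hset]
    calc μ.real (⋃ i, {ω | ¬ p i ω}) ≤ ∑ i, μ.real {ω | ¬ p i ω} :=
          measureReal_iUnion_fintype_le _
      _ ≤ ∑ _i : ι, ε / Fintype.card ι := Finset.sum_le_sum fun i _ => h i
      _ = Fintype.card ι * (ε / Fintype.card ι) := by simp
      _ ≤ ε := by
          rcases eq_or_ne (Fintype.card ι : ℝ) 0 with h0 | h0
          · simpa [h0] using hε
          · rw [mul_div_cancel₀ _ h0]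
  have hone : (1 : ℝ) ≤ μ.real {ω | ∀ i, p i ω} + μ.real {ω | ∀ i, p i ω}ᶜ := by
    calc (1 : ℝ) = μ.real ({ω | ∀ i, p i ω} ∪ {ω | ∀ i, p i ω}ᶜ) := by simp
      _ ≤ _ := measureReal_union_le _ _
  exact ENNReal.ofReal_le_of_le_toReal (by rw [← measureReal_def]; linarith)

/-- PAC bound for a finite class (`card Θ = M`) and the empirical risk minimizer: with
probability at least `1 - ε`, simultaneously for all `θ`,
`R(θ) ≤ r(θ) + C √(log(M/ε)/(2n))`; consequently any empirical risk minimizer `θ̂` has,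
with probability at least `1 - ε`, `R(θ̂) ≤ inf_θ ( r(θ) + C √(log(M/ε)/(2n)) )`. -/
theorem pac_bound_finite_class_erm
    {X Y Θ : Type*} [MeasurableSpace X] [MeasurableSpace Y] [MeasurableSpace Θ]
    [Fintype Θ] [Nonempty Θ]
    (P : Measure (X × Y)) [IsProbabilityMeasure P]
    (f : Θ → X → Y) (ℓ : Y → Y → ℝ) (C : ℝ) (hC : 0 < C)
    (hmeas : Measurable (fun p : Θ × X × Y => ℓ (f p.1 p.2.1) p.2.2))
    (hbound : ∀ y' y : Y, ℓ y' y ∈ Set.Icc 0 C)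
    (n : ℕ) (hn : 0 < n) (ε : ℝ) (hε : ε ∈ Set.Ioo (0:ℝ) 1)
    (M : ℕ) (hM : M = Fintype.card Θ)
    (θERM : (Fin n → X × Y) → Θ)
    (hERM : ∀ ω θ, empRisk f ℓ n ω (θERM ω) ≤ empRisk f ℓ n ω θ) :
    (ENNReal.ofReal (1 - ε) ≤
      (Measure.pi fun _ : Fin n => P)
        {ω | ∀ θ : Θ, risk P f ℓ θ ≤
          empRisk f ℓ n ω θ + C * Real.sqrt (Real.log (M / ε) / (2 * n))})
    ∧ ENNReal.ofReal (1 - ε) ≤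
      (Measure.pi fun _ : Fin n => P)
        {ω | risk P f ℓ (θERM ω) ≤
          ⨅ θ : Θ, (empRisk f ℓ n ω θ + C * Real.sqrt (Real.log (M / ε) / (2 * n)))} := by
  obtain ⟨hε0, hε1⟩ := hε
  have hn' : (0 : ℝ) < n := Nat.cast_pos.mpr hn
  have hM1 : (1 : ℝ) ≤ M := by
    rw [hM]
    exact_mod_cast Fintype.card_pos (α := Θ)
  have hM0 : (0 : ℝ) < M := zero_lt_one.trans_le hM1
  have hlog : 0 ≤ Real.log (M / ε) := Real.log_nonneg ((one_le_div hε0).mpr (hε1.le.trans hM1))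
  have hunif : ENNReal.ofReal (1 - ε) ≤ (Measure.pi fun _ : Fin n => P)
      {ω | ∀ θ : Θ, risk P f ℓ θ ≤
        empRisk f ℓ n ω θ + C * Real.sqrt (Real.log (M / ε) / (2 * n))} := by
    refine ofReal_one_sub_le_measure_setOf_forall _ _ (fun θ => ?_) hε0.le
    simp only [not_le]
    refine (measureReal_pi_mean_add_lt_integral_le P (g := fun p => ℓ (f θ p.1) p.2)
      (hmeas.comp measurable_prodMk_left) hC (fun p => hbound _ _) hn (by positivity)).trans_eq ?_
    have hexp : 2 * n * (C * Real.sqrt (Real.log (M / ε) / (2 * n))) ^ 2 / C ^ 2 =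
        Real.log (M / ε) := by
      rw [mul_pow, Real.sq_sqrt (by positivity)]
      field_simp
    rw [hexp, Real.exp_neg, Real.exp_log (by positivity), inv_div, hM]
  refine ⟨hunif, hunif.trans (measure_mono fun ω hω => ?_)⟩
  exact le_ciInf fun θ => (hω (θERM ω)).trans (by gcongr; exact hERM ω θ)
end

section
/- McAllester–Maurer PAC-Bayes bound for the 0-1 loss: for any ε ∈ (0,1), with probability at least 1 − ε over the i.i.d. sample S, simultaneously for all ρ ∈ P(Θ): E_{θ∼ρ}[R(θ)] ≤ E_{θ∼ρ}[r(θ)] + √( ( KL(ρ‖π) + log(1/ε) + (5/2)·log(n) + 8 ) / (2n − 1) ). -/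
open MeasureTheory
open scoped ENNReal

/- The 0-1 loss: `ℓ(y',y) = 1` if `y' ≠ y` and `0` otherwise. -/
open Classical in
noncomputable def loss01 {Y : Type*} (y' y : Y) : ℝ := if y' = y then 0 else 1

/- The risk `R(θ) = E_{(X,Y)∼P}[ℓ(f_θ(X),Y)]` for the 0-1 loss. -/
noncomputable def risk01 {X Y Θ : Type*} [MeasurableSpace X] [MeasurableSpace Y]
    (P : Measure (X × Y)) (f : Θ → X → Y) (θ : Θ) : ℝ :=
  ∫ p, loss01 (f θ p.1) p.2 ∂P

/- The empirical risk `r(θ) = (1/n) ∑ᵢ ℓ(f_θ(Xᵢ),Yᵢ)` for the 0-1 loss. -/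
noncomputable def empRisk01 {X Y Θ : Type*} (f : Θ → X → Y)
    (n : ℕ) (ω : Fin n → X × Y) (θ : Θ) : ℝ :=
  (∑ i, loss01 (f θ (ω i).1) (ω i).2) / n

open ProbabilityTheory in
/-- The Donsker–Varadhan variational inequality. -/
theorem integral_le_integral_llr_add_log_integral_exp {α : Type*} [MeasurableSpace α]
    {ρ π : Measure α} [IsProbabilityMeasure ρ] [IsProbabilityMeasure π] {g : α → ℝ}
    (hρπ : ρ ≪ π) (hllr : Integrable (llr ρ π) ρ) (hgρ : Integrable g ρ)
    (hgπ : Integrable (fun x => Real.exp (g x)) π) :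
    ∫ x, g x ∂ρ ≤ ∫ x, llr ρ π x ∂ρ + Real.log (∫ x, Real.exp (g x) ∂π) := by
  have := isProbabilityMeasure_tilted hgπ
  have hac : ρ ≪ π.tilted g := hρπ.trans (absolutelyContinuous_tilted hgπ)
  have h := InformationTheory.integral_llr_add_sub_measure_univ_nonneg hac
    (integrable_llr_tilted_right hρπ hgρ hllr hgπ)
  rw [integral_llr_tilted_right hρπ hgρ hgπ hllr, probReal_univ, probReal_univ] at h
  linarith

open ProbabilityTheory in
theorem lintegral_exp_mul_sq_gaussianReal {a : ℝ} (ha : 2 * a < 1) :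
    ∫⁻ z, ENNReal.ofReal (Real.exp (a * z ^ 2)) ∂(gaussianReal 0 1)
      = ENNReal.ofReal (√(1 - 2 * a))⁻¹ := by
  have hb : 0 < 1 / 2 - a := by linarith
  have hz (z : ℝ) : gaussianPDF 0 1 z * ENNReal.ofReal (Real.exp (a * z ^ 2))
      = ENNReal.ofReal ((√(2 * Real.pi))⁻¹ * Real.exp (-(1 / 2 - a) * z ^ 2)) := by
    rw [gaussianPDF, ← ENNReal.ofReal_mul (gaussianPDFReal_nonneg _ _ _), gaussianPDFReal,
      mul_assoc, ← Real.exp_add]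
    norm_num
    ring_nf
  rw [gaussianReal_of_var_ne_zero _ one_ne_zero,
    lintegral_withDensity_eq_lintegral_mul _ (measurable_gaussianPDF 0 1) (by fun_prop)]
  simp only [Pi.mul_apply, hz]
  rw [← ofReal_integral_eq_lintegral_ofReal ((integrable_exp_neg_mul_sq hb).const_mul _)
    (Filter.Eventually.of_forall fun z => by positivity), integral_const_mul, integral_gaussian]
  congr 1
  rw [← Real.sqrt_inv, ← Real.sqrt_inv, ← Real.sqrt_mul (by positivity)]
  congr 1
  have : 1 - 2 * a ≠ 0 := by linarith
  have := hb.ne'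
  field_simp

open ProbabilityTheory in
/-- Square-exponential moment of a sub-Gaussian random variable. -/
theorem ProbabilityTheory.HasSubgaussianMGF.lintegral_exp_mul_sq_le {Ω : Type*}
    [MeasurableSpace Ω] {μ : Measure Ω} [SFinite μ] {Z : Ω → ℝ} {c : NNReal}
    (h : HasSubgaussianMGF Z c μ) {l : ℝ} (hl : 0 ≤ l) (hcl : 2 * (c * l) < 1) :
    ∫⁻ ω, ENNReal.ofReal (Real.exp (l * Z ω ^ 2)) ∂μ
      ≤ ENNReal.ofReal (√(1 - 2 * (c * l)))⁻¹ := by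
  have hZ : AEMeasurable Z μ := h.aemeasurable
  have hs : √(2 * l) ^ 2 = 2 * l := Real.sq_sqrt (by positivity)
  have hlin (ω : Ω) : ENNReal.ofReal (Real.exp (l * Z ω ^ 2))
      = ∫⁻ z, ENNReal.ofReal (Real.exp (√(2 * l) * Z ω * z)) ∂(gaussianReal 0 1) := by
    rw [← ofReal_integral_eq_lintegral_ofReal (integrable_exp_mul_gaussianReal _)
      (Filter.Eventually.of_forall fun z => (Real.exp_pos _).le)]
    have := congrFun (mgf_fun_id_gaussianReal (μ := 0) (v := 1)) (√(2 * l) * Z ω)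
    rw [mgf] at this
    rw [this, mul_pow, hs]
    congr 2
    simp
    ring
  calc ∫⁻ ω, ENNReal.ofReal (Real.exp (l * Z ω ^ 2)) ∂μ
      = ∫⁻ ω, ∫⁻ z, ENNReal.ofReal (Real.exp (√(2 * l) * Z ω * z)) ∂(gaussianReal 0 1) ∂μ := by
        simp_rw [hlin]
    _ = ∫⁻ z, ∫⁻ ω, ENNReal.ofReal (Real.exp (√(2 * l) * Z ω * z)) ∂μ ∂(gaussianReal 0 1) :=
        lintegral_lintegral_swap (by
          have := hZ.comp_fst (ν := gaussianReal 0 1)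
          fun_prop)
    _ ≤ ∫⁻ z, ENNReal.ofReal (Real.exp (c * l * z ^ 2)) ∂(gaussianReal 0 1) := by
        refine lintegral_mono fun z => ?_
        have hcomm (ω : Ω) : √(2 * l) * Z ω * z = (√(2 * l) * z) * Z ω := by ring
        simp_rw [hcomm]
        rw [← ofReal_integral_eq_lintegral_ofReal (h.integrable_exp_mul _)
          (Filter.Eventually.of_forall fun z => (Real.exp_pos _).le)]
        refine ENNReal.ofReal_le_ofReal ((h.mgf_le _).trans_eq ?_)
        rw [mul_pow, hs]
        ring_nf
    _ = _ := lintegral_exp_mul_sq_gaussianReal hcl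

theorem loss01_mem_Icc {Y : Type*} (y' y : Y) : loss01 y' y ∈ Set.Icc (0 : ℝ) 1 := by
  unfold loss01
  split_ifs <;> simp

theorem risk01_mem_Icc {X Y Θ : Type*} [MeasurableSpace X] [MeasurableSpace Y]
    (P : Measure (X × Y)) [IsProbabilityMeasure P] (f : Θ → X → Y) (θ : Θ) :
    risk01 P f θ ∈ Set.Icc (0 : ℝ) 1 := by
  refine ⟨integral_nonneg fun p => (loss01_mem_Icc _ _).1, ?_⟩
  have h := integral_mono_of_nonneg (μ := P) (f := fun p => loss01 (f θ p.1) p.2) (g := fun _ => 1)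
    (Filter.Eventually.of_forall fun p => (loss01_mem_Icc _ _).1) (integrable_const _)
    (Filter.Eventually.of_forall fun p => (loss01_mem_Icc _ _).2)
  simpa [risk01] using h

theorem empRisk01_mem_Icc {X Y Θ : Type*} (f : Θ → X → Y) (n : ℕ) (ω : Fin n → X × Y) (θ : Θ) :
    empRisk01 f n ω θ ∈ Set.Icc (0 : ℝ) 1 := by
  refine ⟨div_nonneg (Finset.sum_nonneg fun i _ => (loss01_mem_Icc _ _).1) n.cast_nonneg,
    div_le_one_of_le₀ ?_ n.cast_nonneg⟩
  simpa using Finset.sum_le_card_nsmul Finset.univ _ (1 : ℝ)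
    fun i _ => (loss01_mem_Icc (f θ (ω i).1) (ω i).2).2

open ProbabilityTheory in
/-- Hoeffding's lemma for the deviation of the empirical risk. -/
theorem hasSubgaussianMGF_risk01_sub_empRisk01 {X Y Θ : Type*} [MeasurableSpace X]
    [MeasurableSpace Y] (P : Measure (X × Y)) [IsProbabilityMeasure P] (f : Θ → X → Y) (θ : Θ)
    (hmeas : Measurable (fun p : X × Y => loss01 (f θ p.1) p.2)) {n : ℕ} (hn : 0 < n) :
    HasSubgaussianMGF (fun ω => risk01 P f θ - empRisk01 f n ω θ) (1 / (4 * n))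
      (Measure.pi fun _ : Fin n => P) := by
  have hP := hasSubgaussianMGF_of_mem_Icc (μ := P) hmeas.aemeasurable
    (Filter.Eventually.of_forall fun p => loss01_mem_Icc (f θ p.1) p.2)
  have hcoord (i : Fin n) := HasSubgaussianMGF.of_map (μ := Measure.pi fun _ : Fin n => P)
    (Y := fun ω => ω i) (measurable_pi_apply i).aemeasurable
    (by rw [(measurePreserving_eval (fun _ : Fin n => P) i).map_eq]; exact hP)
  have hindep : iIndepFun (fun (i : Fin n) (ω : Fin n → X × Y) =>
      loss01 (f θ (ω i).1) (ω i).2 - ∫ p, loss01 (f θ p.1) p.2 ∂P)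
      (Measure.pi fun _ : Fin n => P) :=
    iIndepFun_pi (X := fun _ (p : X × Y) => loss01 (f θ p.1) p.2 - ∫ p, loss01 (f θ p.1) p.2 ∂P)
      fun _ => (hmeas.sub_const _).aemeasurable
  have hsum := (HasSubgaussianMGF.sum_of_iIndepFun hindep (s := Finset.univ)
    fun i _ => hcoord i).const_mul (-(1 / n))
  have hn' : (n : ℝ) ≠ 0 := by positivity
  convert hsum using 1
  · ext ω
    simp only [risk01, empRisk01, Finset.sum_sub_distrib, Finset.sum_const, Finset.card_univ,
      Fintype.card_fin, nsmul_eq_mul]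
    field_simp
    ring
  · ext
    change _ = (-(1 / (n : ℝ))) ^ 2 * ((∑ _i : Fin n, (‖(1 : ℝ) - 0‖₊ / 2) ^ 2 : NNReal) : ℝ)
    simp
    field_simp
    norm_num

open ProbabilityTheory in
/-- On a sample where the exponential moment under the prior is at most `exp K`, the PAC-Bayes
bound holds for every posterior. -/
theorem lintegral_ofReal_le_add_rpow_KL {Θ : Type*} [MeasurableSpace Θ] {π : Measure Θ}
    [IsProbabilityMeasure π] {R r : Θ → ℝ} (hR : Measurable R) (hr : Measurable r)
    (hR01 : ∀ θ, R θ ∈ Set.Icc (0 : ℝ) 1) (hr01 : ∀ θ, r θ ∈ Set.Icc (0 : ℝ) 1)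
    {l K : ℝ} (hl : 0 < l)
    (hK : ∫⁻ θ, ENNReal.ofReal (Real.exp (l * (R θ - r θ) ^ 2)) ∂π
      ≤ ENNReal.ofReal (Real.exp K))
    (ρ : Measure Θ) [IsProbabilityMeasure ρ] :
    ∫⁻ θ, ENNReal.ofReal (R θ) ∂ρ ≤ ∫⁻ θ, ENNReal.ofReal (r θ) ∂ρ
      + ((KL ρ π + ENNReal.ofReal K) / ENNReal.ofReal l) ^ ((1 : ℝ) / 2) := by
  by_cases hKL : ρ ≪ π ∧ Integrable (llr ρ π) ρ
  swap
  · have : KL ρ π = ⊤ := if_neg hKL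
    simp [this, ENNReal.top_div_of_ne_top]
  have hKLeq : KL ρ π = ENNReal.ofReal (∫ θ, llr ρ π θ ∂ρ) := if_pos hKL
  have hd (θ : Θ) : (R θ - r θ) ^ 2 ≤ 1 := by
    have h1 := hR01 θ
    have h2 := hr01 θ
    exact (sq_le_one_iff_abs_le_one _).2
      (abs_le.2 ⟨by linarith [h1.1, h2.2], by linarith [h1.2, h2.1]⟩)
  have hRi : Integrable R ρ := .of_mem_Icc 0 1 hR.aemeasurable (.of_forall hR01)
  have hri : Integrable r ρ := .of_mem_Icc 0 1 hr.aemeasurable (.of_forall hr01)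
  have hgi : Integrable (fun θ => (R θ - r θ) ^ 2) ρ :=
    .of_mem_Icc 0 1 (by fun_prop) (.of_forall fun θ => ⟨sq_nonneg _, hd θ⟩)
  have hei : Integrable (fun θ => Real.exp (l * (R θ - r θ) ^ 2)) π :=
    .of_mem_Icc 0 (Real.exp l) (by fun_prop) (.of_forall fun θ => ⟨(Real.exp_pos _).le,
      Real.exp_le_exp.2 (mul_le_of_le_one_right hl.le (hd θ))⟩)
  have hdv := integral_le_integral_llr_add_log_integral_exp hKL.1 hKL.2 (hgi.const_mul l) hei
  have hlog : Real.log (∫ θ, Real.exp (l * (R θ - r θ) ^ 2) ∂π) ≤ K := by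
    rw [← ofReal_integral_eq_lintegral_ofReal hei (.of_forall fun _ => (Real.exp_pos _).le),
      ENNReal.ofReal_le_ofReal_iff (Real.exp_pos _).le] at hK
    exact (Real.log_le_iff_le_exp (integral_exp_pos hei)).2 hK
  have hjensen : (∫ θ, R θ - r θ ∂ρ) ^ 2 ≤ ∫ θ, (R θ - r θ) ^ 2 ∂ρ := by
    have := variance_nonneg (fun θ => R θ - r θ) ρ
    rw [variance_eq_sub (MemLp.of_bound (by fun_prop) 1 (.of_forall fun θ => by
      simpa [sq_le_one_iff_abs_le_one] using hd θ))] at this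
    simpa using this
  rw [integral_const_mul] at hdv
  rw [integral_sub hRi hri] at hjensen
  have hsq : (∫ θ, R θ ∂ρ - ∫ θ, r θ ∂ρ) ^ 2 ≤ (∫ θ, llr ρ π θ ∂ρ + K) / l := by
    rw [le_div_iff₀ hl]
    nlinarith
  have hle : ∫ θ, R θ ∂ρ ≤ ∫ θ, r θ ∂ρ + √((∫ θ, llr ρ π θ ∂ρ + K) / l) := by
    linarith [Real.le_sqrt_of_sq_le hsq]
  rw [← ofReal_integral_eq_lintegral_ofReal hRi (.of_forall fun θ => (hR01 θ).1),
    ← ofReal_integral_eq_lintegral_ofReal hri (.of_forall fun θ => (hr01 θ).1), hKLeq]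
  refine (ENNReal.ofReal_le_ofReal hle).trans (ENNReal.ofReal_add_le.trans ?_)
  gcongr
  rw [Real.sqrt_eq_rpow, ← ENNReal.ofReal_rpow_of_nonneg ((sq_nonneg _).trans hsq) (by norm_num),
    ENNReal.ofReal_div_of_pos hl]
  gcongr
  exact ENNReal.ofReal_add_le

/-- McAllester–Maurer PAC-Bayes bound for the 0-1 loss: with probability at least
`1 - ε`, simultaneously for all `ρ ∈ P(Θ)`,
`E_{θ∼ρ}[R(θ)] ≤ E_{θ∼ρ}[r(θ)] + √((KL(ρ‖π) + log(1/ε) + (5/2)log n + 8)/(2n-1))`. -/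
theorem mcallester_maurer_pac_bayes_bound
    {X Y Θ : Type*} [MeasurableSpace X] [MeasurableSpace Y] [MeasurableSpace Θ]
    (P : Measure (X × Y)) [IsProbabilityMeasure P]
    (f : Θ → X → Y)
    (hmeas : Measurable (fun p : Θ × X × Y => loss01 (f p.1 p.2.1) p.2.2))
    (π : Measure Θ) [IsProbabilityMeasure π]
    (n : ℕ) (hn : 0 < n) (ε : ℝ) (hε : ε ∈ Set.Ioo (0:ℝ) 1) :
    ENNReal.ofReal (1 - ε) ≤
      (Measure.pi fun _ : Fin n => P)
        {ω | ∀ ρ : Measure Θ, IsProbabilityMeasure ρ →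
          ∫⁻ θ, ENNReal.ofReal (risk01 P f θ) ∂ρ ≤
            (∫⁻ θ, ENNReal.ofReal (empRisk01 f n ω θ) ∂ρ)
              + ((KL ρ π
                    + ENNReal.ofReal
                        (Real.log (1 / ε) + (5 / 2) * Real.log n + 8))
                  / (2 * (n : ℝ≥0∞) - 1)) ^ ((1 : ℝ) / 2)} := by
  have hε0 : 0 < ε := hε.1
  have hn1 : (1 : ℝ) ≤ n := by exact_mod_cast hn
  set μ := Measure.pi fun _ : Fin n => P with hμ
  set K := Real.log (1 / ε) + (5 / 2) * Real.log n + 8 with hKdef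
  have hl : (0 : ℝ) < 2 * n - 1 := by linarith
  have hden : 2 * (n : ℝ≥0∞) - 1 = ENNReal.ofReal (2 * n - 1) := by
    rw [ENNReal.ofReal_sub _ zero_le_one, ENNReal.ofReal_mul zero_le_two]
    simp
  have hloss (θ : Θ) : Measurable (fun p : X × Y => loss01 (f θ p.1) p.2) :=
    hmeas.comp measurable_prodMk_left
  have hR : Measurable (risk01 P f) :=
    (hmeas.stronglyMeasurable.integral_prod_right (ν := P)).measurable
  have hr : Measurable (fun q : (Fin n → X × Y) × Θ => empRisk01 f n q.1 q.2) := by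
    refine Measurable.div_const (Finset.measurable_sum _ fun i _ => ?_) _
    exact hmeas.comp (measurable_snd.prodMk ((measurable_pi_apply i).comp measurable_fst))
  set G : (Fin n → X × Y) → Θ → ℝ≥0∞ := fun ω θ =>
    ENNReal.ofReal (Real.exp ((2 * n - 1) * (risk01 P f θ - empRisk01 f n ω θ) ^ 2)) with hG
  have hGm : Measurable (Function.uncurry G) := by
    have : Measurable fun q : (Fin n → X × Y) × Θ => risk01 P f q.2 := hR.comp measurable_snd
    simp only [hG, Function.uncurry_def]
    fun_prop
  have hFm : Measurable fun ω => ∫⁻ θ, G ω θ ∂π := hGm.lintegral_prod_right'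
  have hmoment : ∫⁻ ω, ∫⁻ θ, G ω θ ∂π ∂μ ≤ ENNReal.ofReal √(2 * n) := by
    rw [lintegral_lintegral_swap hGm.aemeasurable]
    have hθ (θ : Θ) : ∫⁻ ω, G ω θ ∂μ ≤ ENNReal.ofReal √(2 * n) := by
      have hcoef : 1 - 2 * (((1 / (4 * n) : NNReal) : ℝ) * (2 * n - 1)) = (2 * n : ℝ)⁻¹ := by
        push_cast
        field_simp
        ring
      have h := (hasSubgaussianMGF_risk01_sub_empRisk01 P f θ (hloss θ) hn).lintegral_exp_mul_sq_le
        hl.le (by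
          have : (0 : ℝ) < (2 * n : ℝ)⁻¹ := by positivity
          linarith)
      rwa [hcoef, Real.sqrt_inv, inv_inv] at h
    simpa using lintegral_mono (μ := π) hθ
  have hsqrt : √(2 * n) ≤ ε * Real.exp K := by
    have hexp : ε * Real.exp K = Real.exp ((5 / 2) * Real.log n) * Real.exp 8 := by
      rw [hKdef, Real.exp_add, Real.exp_add, Real.exp_log (by positivity)]
      field_simp
    have h1 : (n : ℝ) ≤ Real.exp ((5 / 2) * Real.log n) := by
      rw [← Real.log_le_iff_le_exp (by positivity)]
      linarith [Real.log_nonneg hn1]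
    have h2 : (2 : ℝ) ≤ Real.exp 8 := by linarith [Real.add_one_le_exp (8 : ℝ)]
    rw [hexp]
    calc √(2 * n) ≤ 2 * n := Real.sqrt_le_self_iff.2 (.inr (by linarith))
      _ = n * 2 := mul_comm _ _
      _ ≤ _ := by gcongr
  have hmarkov : μ {ω | ENNReal.ofReal (Real.exp K) ≤ ∫⁻ θ, G ω θ ∂π} ≤ ENNReal.ofReal ε := by
    refine (meas_ge_le_lintegral_div hFm.aemeasurable (by simp [Real.exp_pos])
      ENNReal.ofReal_ne_top).trans (ENNReal.div_le_of_le_mul ?_)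
    rw [← ENNReal.ofReal_mul hε0.le]
    exact hmoment.trans (ENNReal.ofReal_le_ofReal hsqrt)
  have hcompl : ENNReal.ofReal (1 - ε)
      ≤ μ {ω | ENNReal.ofReal (Real.exp K) ≤ ∫⁻ θ, G ω θ ∂π}ᶜ := by
    rw [prob_compl_eq_one_sub (measurableSet_le measurable_const hFm),
      ENNReal.ofReal_sub _ hε0.le, ENNReal.ofReal_one]
    gcongr
  refine hcompl.trans (measure_mono fun ω hω ρ hρ => ?_)
  rw [hden]
  exact lintegral_ofReal_le_add_rpow_KL hR (hr.comp measurable_prodMk_left)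
    (risk01_mem_Icc P f) (empRisk01_mem_Icc f n ω) hl (le_of_not_ge hω) ρ
end

section
/- Seeger–Maurer PAC-Bayes bound for the 0-1 loss: for any ε ∈ (0,1), with probability at least 1 − ε over the i.i.d. sample S, simultaneously for all ρ ∈ P(Θ): kl( E_{θ∼ρ}[r(θ)] | E_{θ∼ρ}[R(θ)] ) ≤ ( KL(ρ‖π) + log(2√n / ε) ) / n, where kl(p|q) = p·log(p/q) + (1−p)·log((1−p)/(1−q)) is the Kullback–Leibler divergence between Bernoulli distributions of parameters p and q. -/
open MeasureTheory
open scoped ENNReal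

/- The Kullback-Leibler divergence between Bernoulli distributions of parameters `p`
and `q`: `kl(p|q) = p log(p/q) + (1-p) log((1-p)/(1-q))`. -/
noncomputable def klBernoulli (p q : ℝ) : ℝ :=
  p * Real.log (p / q) + (1 - p) * Real.log ((1 - p) / (1 - q))


theorem hasDerivAt_sum_descFactorial_mul_pow (n : ℕ) (z : ℝ) :
    HasDerivAt (fun z : ℝ => ∑ i ∈ Finset.range (n + 2),
        ((n + 1).descFactorial i : ℝ) * z ^ (n + 1 - i))
      ((n + 1) * ∑ i ∈ Finset.range (n + 1), (n.descFactorial i : ℝ) * z ^ (n - i)) z := by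
  have h := HasDerivAt.fun_sum (u := Finset.range (n + 2)) fun i _ =>
    (hasDerivAt_pow (n + 1 - i) z).const_mul ((n + 1).descFactorial i : ℝ)
  refine h.congr_deriv (Eq.symm ?_)
  rw [Finset.sum_range_succ _ (n + 1), Finset.mul_sum]
  simp only [Nat.sub_self, Nat.cast_zero, zero_mul, mul_zero, add_zero]
  refine Finset.sum_congr rfl fun i _ => ?_
  have e : ((n + 1 - i : ℕ) : ℝ) * (n + 1).descFactorial i = (n + 1) * n.descFactorial i := by
    exact_mod_cast (Nat.descFactorial_succ (n + 1) i).symm.trans (Nat.succ_descFactorial_succ n i)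
  rw [show n + 1 - i - 1 = n - i by omega]
  linear_combination (-z ^ (n - i)) * e

theorem hasDerivAt_sum_choose_mul_pow_mul_pow (n : ℕ) (x y : ℝ) :
    HasDerivAt (fun y : ℝ => ∑ k ∈ Finset.range (n + 2),
        ((n + 1).choose k : ℝ) * (x + k) ^ k * (y + (n + 1 - k : ℕ)) ^ (n + 1 - k))
      ((n + 1) * ∑ k ∈ Finset.range (n + 1),
        (n.choose k : ℝ) * (x + k) ^ k * ((y + 1) + (n - k : ℕ)) ^ (n - k)) y := by
  have h := HasDerivAt.fun_sum (u := Finset.range (n + 2)) fun k _ =>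
    (((hasDerivAt_id y).add_const ((n + 1 - k : ℕ) : ℝ)).fun_pow (n + 1 - k)).const_mul
      (((n + 1).choose k : ℝ) * (x + k) ^ k)
  refine h.congr_deriv (Eq.symm ?_)
  rw [Finset.sum_range_succ _ (n + 1), Finset.mul_sum]
  simp only [Nat.sub_self, Nat.cast_zero, zero_mul, mul_zero, add_zero]
  refine Finset.sum_congr rfl fun k hk => ?_
  have hk' : k ≤ n := Nat.lt_succ_iff.1 (Finset.mem_range.1 hk)
  have e : (n.choose k : ℝ) * (n + 1) = (n + 1).choose k * (n + 1 - k : ℕ) := by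
    exact_mod_cast Nat.choose_mul_succ_eq n k
  rw [show n + 1 - k - 1 = n - k by omega, show n + 1 - k = (n - k) + 1 by omega] at *
  push_cast at e ⊢
  simp only [id]
  rw [show y + ((n - k : ℕ) + 1 : ℝ) = y + 1 + (n - k : ℕ) by ring]
  linear_combination ((x + k) ^ k * (y + 1 + (n - k : ℕ)) ^ (n - k)) * e

/-- A binomial identity of Abel type: the left-hand side depends on `x + y` only. -/
theorem sum_choose_mul_pow_mul_pow (n : ℕ) (x y : ℝ) :
    ∑ k ∈ Finset.range (n + 1), (n.choose k : ℝ) * (x + k) ^ k * (y + (n - k : ℕ)) ^ (n - k) =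
      ∑ i ∈ Finset.range (n + 1), (n.descFactorial i : ℝ) * (x + y + n) ^ (n - i) := by
  induction n generalizing x y with
  | zero => simp
  | succ n ih =>
    have hd (y : ℝ) := (hasDerivAt_sum_choose_mul_pow_mul_pow n x y).sub
      ((hasDerivAt_sum_descFactorial_mul_pow n (x + y + (n + 1 : ℕ))).comp y
        (((hasDerivAt_id y).const_add x).add_const ((n + 1 : ℕ) : ℝ)))
    have hc := is_const_of_deriv_eq_zero (fun y => (hd y).differentiableAt) (fun y => by
      rw [(hd y).deriv, ih x (y + 1), show x + (y + 1) + n = x + y + (n + 1 : ℕ) by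
        push_cast; ring, mul_one, sub_self]) y (-x - (n + 1 : ℕ))
    have h0 : ∑ i ∈ Finset.range (n + 2), ((n + 1).descFactorial i : ℝ) * 0 ^ (n + 1 - i) =
        (n + 1).factorial := by
      rw [Finset.sum_range_succ, Finset.sum_eq_zero]
      · rw [Nat.descFactorial_self, Nat.sub_self, pow_zero, zero_add, mul_one]
      · intro i hi
        rw [zero_pow (by have := Finset.mem_range.1 hi; omega), mul_zero]
    have h1 : ∑ k ∈ Finset.range (n + 2), ((n + 1).choose k : ℝ) * (x + k) ^ k *
        (-x - (n + 1 : ℕ) + (n + 1 - k : ℕ)) ^ (n + 1 - k) = (n + 1).factorial := by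
      have h := congrFun (fwdDiff_iter_eq_factorial (R := ℝ) (n := n + 1)) x
      rw [fwdDiff_iter_eq_sum_shift] at h
      refine Eq.trans (Finset.sum_congr rfl fun k hk => ?_) h
      have hk' : k ≤ n + 1 := Nat.lt_succ_iff.1 (Finset.mem_range.1 hk)
      rw [show -x - (n + 1 : ℕ) + (n + 1 - k : ℕ) = -1 * (x + k) by
        rw [Nat.cast_sub hk']; ring, mul_pow, zsmul_eq_mul, nsmul_one]
      have hp : (x + k) ^ (n + 1) = (x + k) ^ k * (x + k) ^ (n + 1 - k) := by
        rw [← pow_add, Nat.add_sub_cancel' hk']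
      push_cast
      rw [hp]
      ring
    simp only [Pi.sub_apply, Function.comp_apply, id] at hc
    rw [h1, show x + (-x - ((n + 1 : ℕ) : ℝ)) + (n + 1 : ℕ) = 0 by ring, h0, sub_self] at hc
    exact sub_eq_zero.1 hc

theorem sum_descFactorial_div_pow_le (n : ℕ) (hn : 0 < n) :
    ∑ i ∈ Finset.range (n + 1), (n.descFactorial i : ℝ) / n ^ i ≤ 2 * Real.sqrt n := by
  have hn' : (1 : ℝ) ≤ n := by exact_mod_cast hn
  have key (m : ℕ) : 0 ≤ ∑ i ∈ Finset.range m, (n.descFactorial i : ℝ) / n ^ i ∧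
      ∑ i ∈ Finset.range m, (n.descFactorial i : ℝ) / n ^ i ≤ m ∧
      (∑ i ∈ Finset.range m, (n.descFactorial i : ℝ) / n ^ i) *
        (∑ i ∈ Finset.range m, (n.descFactorial i : ℝ) / n ^ i - 1) ≤
          2 * n * (1 - (n.descFactorial m : ℝ) / n ^ m) := by
    induction m with
    | zero => simp
    | succ m ih =>
      obtain ⟨h0, h1, h2⟩ := ih
      rw [Finset.sum_range_succ]
      set s := ∑ i ∈ Finset.range m, (n.descFactorial i : ℝ) / n ^ i
      have ha0 : 0 ≤ (n.descFactorial m : ℝ) / n ^ m := by positivity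
      have ha1 : (n.descFactorial m : ℝ) / n ^ m ≤ 1 :=
        div_le_one_of_le₀ (by exact_mod_cast Nat.descFactorial_le_pow n m) (by positivity)
      have hr : n * ((n.descFactorial (m + 1) : ℝ) / n ^ (m + 1)) =
          (n - m) * ((n.descFactorial m : ℝ) / n ^ m) := by
        have e : (n.descFactorial (m + 1) : ℝ) = (n - m) * n.descFactorial m := by
          rcases le_or_gt m n with h | h
          · rw [Nat.descFactorial_succ, Nat.cast_mul, Nat.cast_sub h]
          · simp [Nat.descFactorial_of_lt h]
        rw [e]
        field_simp
        ring
      set a := (n.descFactorial m : ℝ) / n ^ m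
      refine ⟨by positivity, by push_cast; linarith, ?_⟩
      have : 0 ≤ a * (2 * (m - s) + (1 - a)) := mul_nonneg ha0 (by linarith)
      linarith
  obtain ⟨h0, -, h2⟩ := key (n + 1)
  set s := ∑ i ∈ Finset.range (n + 1), (n.descFactorial i : ℝ) / n ^ i
  have ha0 : 0 ≤ (n.descFactorial (n + 1) : ℝ) / n ^ (n + 1) := by positivity
  have hs : s * (s - 1) ≤ 2 * n := by nlinarith
  have hq : Real.sqrt n ^ 2 = n := Real.sq_sqrt (by linarith)
  have hq1 : 1 ≤ Real.sqrt n := Real.one_le_sqrt.2 hn'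
  by_contra! h
  nlinarith [mul_pos (sub_pos.2 h) (show 0 < s + 2 * Real.sqrt n - 1 by linarith)]

theorem sum_choose_mul_div_pow_le (n : ℕ) (hn : 0 < n) :
    ∑ k ∈ Finset.range (n + 1), (n.choose k : ℝ) *
      (((k : ℝ) / n) ^ k * (1 - (k : ℝ) / n) ^ (n - k)) ≤ 2 * Real.sqrt n := by
  refine le_trans (le_of_eq ?_) (sum_descFactorial_div_pow_le n hn)
  have hn' : (n : ℝ) ≠ 0 := by exact_mod_cast hn.ne'
  have h := sum_choose_mul_pow_mul_pow n 0 0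
  simp only [zero_add] at h
  have h' := congrArg (fun t : ℝ => t / n ^ n) h
  simp only [Finset.sum_div] at h'
  refine Eq.trans (Finset.sum_congr rfl fun k hk => ?_)
    (h'.trans (Finset.sum_congr rfl fun i hi => ?_))
  · have hk' : k ≤ n := Nat.lt_succ_iff.1 (Finset.mem_range.1 hk)
    have hp : (n : ℝ) ^ n = n ^ k * n ^ (n - k) := by rw [← pow_add, Nat.add_sub_cancel' hk']
    rw [hp, one_sub_div hn', div_pow, div_pow, Nat.cast_sub hk']
    field_simp
  · have hi' : i ≤ n := Nat.lt_succ_iff.1 (Finset.mem_range.1 hi)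
    have hp : (n : ℝ) ^ n = n ^ i * n ^ (n - i) := by rw [← pow_add, Nat.add_sub_cancel' hi']
    rw [hp]
    field_simp

theorem pow_mul_exp_log_div_le (k : ℕ) {x y : ℝ} (hx : k ≠ 0 → 0 < x) (hy : 0 ≤ y) :
    y ^ k * Real.exp (k * Real.log (x / y)) ≤ x ^ k := by
  rcases eq_or_ne k 0 with rfl | hk
  · simp
  have hx := hx hk
  rcases hy.eq_or_lt with rfl | hy
  · rw [zero_pow hk, zero_mul]
    positivity
  · rw [← Real.log_pow, Real.exp_log (by positivity), div_pow,
      mul_div_cancel₀ _ (by positivity)]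

theorem pow_mul_pow_mul_exp_klBernoulli_le {n k : ℕ} (hk : k ≤ n) (hn : 0 < n) {q : ℝ}
    (hq : q ∈ Set.Icc (0 : ℝ) 1) :
    q ^ k * (1 - q) ^ (n - k) * Real.exp (n * klBernoulli (k / n) q) ≤
      ((k : ℝ) / n) ^ k * (1 - (k : ℝ) / n) ^ (n - k) := by
  have hn' : (0 : ℝ) < n := by exact_mod_cast hn
  have h1 := pow_mul_exp_log_div_le k (x := (k : ℝ) / n) (y := q)
    (fun h => div_pos (by exact_mod_cast Nat.pos_of_ne_zero h) hn') hq.1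
  have h2 := pow_mul_exp_log_div_le (n - k) (x := 1 - (k : ℝ) / n) (y := 1 - q)
    (fun h => by
      rw [sub_pos, div_lt_one hn']
      exact_mod_cast show k < n by omega) (sub_nonneg.2 hq.2)
  have e : n * klBernoulli (k / n) q = k * Real.log ((k : ℝ) / n / q) +
      ((n - k : ℕ) : ℝ) * Real.log ((1 - (k : ℝ) / n) / (1 - q)) := by
    rw [klBernoulli, Nat.cast_sub hk]
    field_simp
  rw [e, Real.exp_add]
  calc _ = q ^ k * Real.exp (k * Real.log ((k : ℝ) / n / q)) * ((1 - q) ^ (n - k) *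
        Real.exp (((n - k : ℕ) : ℝ) * Real.log ((1 - (k : ℝ) / n) / (1 - q)))) := by ring
    _ ≤ _ := mul_le_mul h1 h2
      (mul_nonneg (pow_nonneg (sub_nonneg.2 hq.2) _) (Real.exp_pos _).le)
      (pow_nonneg (by positivity) _)

theorem mul_log_add_sub_le {x y c : ℝ} (hx : 0 ≤ x) (hy : 0 ≤ y) (hxy : y = 0 → x = 0)
    (hc : 0 < c) : x * Real.log c + x - c * y ≤ x * Real.log (x / y) := by
  rcases hx.eq_or_lt with rfl | hx
  · have := mul_nonneg hc.le hy
    simpa using this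
  have hy : 0 < y := hy.lt_of_ne fun h => hx.ne' (hxy h.symm)
  have h := Real.log_le_sub_one_of_pos (show 0 < c * y / x by positivity)
  rw [Real.log_div (by positivity) hx.ne', Real.log_mul hc.ne' hy.ne'] at h
  rw [Real.log_div hx.ne' hy.ne']
  have h' := mul_le_mul_of_nonneg_left h hx.le
  rw [mul_sub x (c * y / x) 1, mul_div_cancel₀ _ hx.ne'] at h'
  linarith

theorem mul_log_div_le_of_forall {x y B : ℝ} (hx : 0 ≤ x) (hy : 0 ≤ y)
    (h : ∀ c : ℝ, 0 < c → x * Real.log c + x - c * y ≤ B) : x * Real.log (x / y) ≤ B := by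
  rcases hy.eq_or_lt with rfl | hy
  · have := h 1 one_pos
    simp only [Real.log_one, mul_zero, zero_add, sub_zero, div_zero, Real.log_zero] at this ⊢
    linarith
  rcases hx.eq_or_lt with rfl | hx
  · rw [zero_mul]
    refine le_of_forall_pos_lt_add fun δ hδ => ?_
    have := h (δ / (2 * y)) (by positivity)
    have e : δ / (2 * y) * y = δ / 2 := by field_simp
    rw [e] at this
    linarith
  · have := h (x / y) (by positivity)
    rw [div_mul_cancel₀ _ hy.ne'] at this
    linarith

/-- An affine minorant of `klBernoulli`, indexed by the slopes `c` and `d`. -/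
noncomputable def klBernoulliMinorant (c d p q : ℝ) : ℝ :=
  (p * Real.log c + p - c * q) + ((1 - p) * Real.log d + (1 - p) - d * (1 - q))

theorem klBernoulliMinorant_le {c d p q : ℝ} (hc : 0 < c) (hd : 0 < d)
    (hp : p ∈ Set.Icc (0 : ℝ) 1) (hq : q ∈ Set.Icc (0 : ℝ) 1) (h0 : q = 0 → p = 0)
    (h1 : q = 1 → p = 1) : klBernoulliMinorant c d p q ≤ klBernoulli p q :=
  add_le_add (mul_log_add_sub_le hp.1 hq.1 h0 hc)
    (mul_log_add_sub_le (sub_nonneg.2 hp.2) (sub_nonneg.2 hq.2)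
      (fun h => by rw [h1 (sub_eq_zero.1 h).symm, sub_self]) hd)

theorem klBernoulli_le_of_forall_minorant_le {p q B : ℝ}
    (hp : p ∈ Set.Icc (0 : ℝ) 1) (hq : q ∈ Set.Icc (0 : ℝ) 1)
    (h : ∀ c d : ℝ, 0 < c → 0 < d → klBernoulliMinorant c d p q ≤ B) :
    klBernoulli p q ≤ B := by
  have h' : (1 - p) * Real.log ((1 - p) / (1 - q)) ≤ B - p * Real.log (p / q) :=
    mul_log_div_le_of_forall (sub_nonneg.2 hp.2) (sub_nonneg.2 hq.2) fun d hd => by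
      have : p * Real.log (p / q) ≤ B - ((1 - p) * Real.log d + (1 - p) - d * (1 - q)) :=
        mul_log_div_le_of_forall hp.1 hq.1 fun c hc => by
          have := h c d hc hd
          rw [klBernoulliMinorant] at this
          linarith
      linarith
  rw [klBernoulli]
  linarith

/-- Donsker–Varadhan inequality. -/
theorem integral_le_KL_add_log_integral_exp {Θ : Type*} [MeasurableSpace Θ] {ρ π : Measure Θ}
    [IsProbabilityMeasure ρ] [IsProbabilityMeasure π] (hKL : KL ρ π ≠ ⊤) {T : Θ → ℝ}
    (hρ : Integrable T ρ) (hπ : Integrable (fun θ => Real.exp (T θ)) π) :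
    ∫ θ, T θ ∂ρ ≤ (KL ρ π).toReal + Real.log (∫ θ, Real.exp (T θ) ∂π) := by
  by_cases h : ρ ≪ π ∧ Integrable (fun θ => Real.log ((ρ.rnDeriv π) θ).toReal) ρ
  swap
  · exact absurd (if_neg h) hKL
  rw [KL, if_pos h, ENNReal.toReal_ofReal']
  have := isProbabilityMeasure_tilted hπ
  have hac : ρ ≪ π.tilted T := h.1.trans (absolutelyContinuous_tilted hπ)
  have h1 := InformationTheory.integral_llr_add_sub_measure_univ_nonneg hac
    (integrable_llr_tilted_right h.1 hρ h.2 hπ)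
  rw [integral_llr_tilted_right h.1 hρ hπ h.2] at h1
  simp only [probReal_univ, llr] at h1
  have := le_max_left (∫ θ, Real.log ((ρ.rnDeriv π) θ).toReal ∂ρ) 0
  linarith

theorem apply_sum_eq_sum_powerset {n : ℕ} (b : Fin n → ℝ) (hb : ∀ i, b i = 0 ∨ b i = 1)
    (H : ℝ → ℝ) : H (∑ i, b i) = ∑ s : Finset (Fin n),
      (∏ i, if i ∈ s then b i else 1 - b i) * H s.card := by
  classical
  have hb' (i) : b i = if b i = 1 then 1 else 0 := by
    rcases hb i with h | h <;> simp [h]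
  rw [Finset.sum_eq_single (Finset.univ.filter fun i => b i = 1)]
  · rw [Finset.prod_eq_one, one_mul]
    · congr 1
      rw [Finset.card_filter]
      push_cast
      exact Finset.sum_congr rfl fun i _ => hb' i
    · intro i _
      rcases hb i with h | h <;> simp [h]
  · intro s _ hs
    obtain ⟨i, hi⟩ : ∃ i, ¬(i ∈ s ↔ b i = 1) := by
      by_contra! hc
      exact hs (by ext i; rw [hc i]; simp)
    rw [Finset.prod_eq_zero (Finset.mem_univ i), zero_mul]
    clear hb'
    rcases hb i with h | h <;> simp_all
  · simp

theorem integrable_apply_sum_pi {Z : Type*} [MeasurableSpace Z] (P : Measure Z)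
    [IsProbabilityMeasure P] {l : Z → ℝ} (hl : Measurable l) (hb : ∀ z, l z = 0 ∨ l z = 1)
    (n : ℕ) (H : ℝ → ℝ) :
    Integrable (fun ω => H (∑ i, l (ω i))) (Measure.pi fun _ : Fin n => P) := by
  have hInt : Integrable l P := Integrable.of_bound hl.aestronglyMeasurable 1
    (ae_of_all _ fun z => by rcases hb z with h | h <;> simp [h])
  refine Integrable.congr (integrable_finsetSum Finset.univ fun s _ =>
    (Integrable.fintype_prod (f := fun i z => if i ∈ s then l z else 1 - l z)
      fun i => ?_).mul_const (H s.card))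
    (ae_of_all _ fun ω => (apply_sum_eq_sum_powerset (fun i => l (ω i)) (fun i => hb _) H).symm)
  by_cases h : i ∈ s
  · simpa only [if_pos h] using hInt
  · simp only [if_neg h]
    exact (integrable_const 1).sub hInt

theorem integral_apply_sum_pi {Z : Type*} [MeasurableSpace Z] (P : Measure Z)
    [IsProbabilityMeasure P] {l : Z → ℝ} (hl : Measurable l) (hb : ∀ z, l z = 0 ∨ l z = 1)
    (n : ℕ) (H : ℝ → ℝ) :
    ∫ ω, H (∑ i, l (ω i)) ∂(Measure.pi fun _ : Fin n => P) =
      ∑ k ∈ Finset.range (n + 1), (n.choose k : ℝ) *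
        ((∫ z, l z ∂P) ^ k * (1 - ∫ z, l z ∂P) ^ (n - k) * H k) := by
  have hInt : Integrable l P := Integrable.of_bound hl.aestronglyMeasurable 1
    (ae_of_all _ fun z => by rcases hb z with h | h <;> simp [h])
  have hInt' (s : Finset (Fin n)) (i : Fin n) :
      Integrable (fun z => if i ∈ s then l z else 1 - l z) P := by
    split_ifs
    exacts [hInt, (integrable_const 1).sub hInt]
  have hval (s : Finset (Fin n)) (i : Fin n) : ∫ z, (if i ∈ s then l z else 1 - l z) ∂P =
      if i ∈ s then ∫ z, l z ∂P else 1 - ∫ z, l z ∂P := by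
    split_ifs
    · rfl
    · rw [integral_sub (integrable_const 1) hInt]
      simp
  calc ∫ ω, H (∑ i, l (ω i)) ∂(Measure.pi fun _ : Fin n => P)
      = ∫ ω, ∑ s : Finset (Fin n), (∏ i, if i ∈ s then l (ω i) else 1 - l (ω i)) * H s.card
          ∂(Measure.pi fun _ : Fin n => P) := by
        congr 1 with ω
        exact apply_sum_eq_sum_powerset (fun i => l (ω i)) (fun i => hb _) H
    _ = ∑ s : Finset (Fin n),
          (∫ z, l z ∂P) ^ s.card * (1 - ∫ z, l z ∂P) ^ (n - s.card) * H s.card := by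
        rw [integral_finsetSum _ fun s _ =>
          (Integrable.fintype_prod (f := fun i z => if i ∈ s then l z else 1 - l z)
            (hInt' s)).mul_const _]
        refine Finset.sum_congr rfl fun s _ => ?_
        rw [integral_mul_const,
          integral_fintype_prod_eq_prod (fun i z => if i ∈ s then l z else 1 - l z)]
        simp only [hval]
        rw [Finset.prod_ite, Finset.prod_const, Finset.prod_const, Finset.filter_mem_eq_inter,
          Finset.univ_inter, Finset.filter_not, Finset.filter_mem_eq_inter, Finset.univ_inter,
          Finset.card_sdiff_of_subset (Finset.subset_univ _), Finset.card_univ, Fintype.card_fin]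
    _ = _ := by
        have := Finset.sum_powerset_apply_card (fun k => (∫ z, l z ∂P) ^ k *
          (1 - ∫ z, l z ∂P) ^ (n - k) * H k) (x := (Finset.univ : Finset (Fin n)))
        simpa using this

theorem integral_mem_Icc {Z : Type*} [MeasurableSpace Z] (P : Measure Z)
    [IsProbabilityMeasure P] {l : Z → ℝ} (hl : Measurable l) (hb : ∀ z, l z ∈ Set.Icc (0 : ℝ) 1) :
    ∫ z, l z ∂P ∈ Set.Icc (0 : ℝ) 1 := by
  refine ⟨integral_nonneg fun z => (hb z).1, ?_⟩
  have := integral_mono (μ := P) (Integrable.of_bound hl.aestronglyMeasurable 1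
    (ae_of_all _ fun z => by
      rw [Real.norm_of_nonneg (hb z).1]
      exact (hb z).2)) (integrable_const 1) fun z => (hb z).2
  simpa using this

theorem lintegral_exp_klBernoulli_le {Z : Type*} [MeasurableSpace Z] (P : Measure Z)
    [IsProbabilityMeasure P] {l : Z → ℝ} (hl : Measurable l) (hb : ∀ z, l z = 0 ∨ l z = 1)
    (n : ℕ) (hn : 0 < n) :
    ∫⁻ ω, ENNReal.ofReal (Real.exp (n * klBernoulli ((∑ i, l (ω i)) / n) (∫ z, l z ∂P)))
      ∂(Measure.pi fun _ : Fin n => P) ≤ ENNReal.ofReal (2 * Real.sqrt n) := by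
  rw [← ofReal_integral_eq_lintegral_ofReal (integrable_apply_sum_pi P hl hb n fun t =>
    Real.exp (n * klBernoulli (t / n) (∫ z, l z ∂P))) (ae_of_all _ fun _ => (Real.exp_pos _).le)]
  refine ENNReal.ofReal_le_ofReal ?_
  rw [integral_apply_sum_pi P hl hb n fun t =>
    Real.exp (n * klBernoulli (t / n) (∫ z, l z ∂P))]
  refine le_trans (Finset.sum_le_sum fun k hk => ?_) (sum_choose_mul_div_pow_le n hn)
  exact mul_le_mul_of_nonneg_left (pow_mul_pow_mul_exp_klBernoulli_le
    (Nat.lt_succ_iff.1 (Finset.mem_range.1 hk)) hn (integral_mem_Icc P hl fun z => by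
      rcases hb z with h | h <;> simp [h])) (Nat.cast_nonneg _)

theorem ae_pi_mean_eq_of_ae_eq {Z : Type*} [MeasurableSpace Z] {P : Measure Z}
    [IsProbabilityMeasure P] {l : Z → ℝ} {n : ℕ} (hn : 0 < n) {a : ℝ} (h : ∀ᵐ z ∂P, l z = a) :
    ∀ᵐ ω ∂(Measure.pi fun _ : Fin n => P), (∑ i, l (ω i)) / n = a := by
  have h' : ∀ᵐ ω ∂(Measure.pi fun _ : Fin n => P), ∀ i, l (ω i) = a :=
    Filter.eventually_all.2 fun i => 
      (Measure.tendsto_eval_ae_ae (μ := fun _ : Fin n => P) (i := i)).eventually h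
  filter_upwards [h'] with ω hω
  have hn' : (n : ℝ) ≠ 0 := by exact_mod_cast hn.ne'
  simp [hω, hn']

theorem ae_pi_mean_eq_of_integral_eq {Z : Type*} [MeasurableSpace Z] (P : Measure Z)
    [IsProbabilityMeasure P] {l : Z → ℝ} (hl : Measurable l) (hb : ∀ z, l z ∈ Set.Icc (0 : ℝ) 1)
    {n : ℕ} (hn : 0 < n) :
    ∀ᵐ ω ∂(Measure.pi fun _ : Fin n => P),
      (∫ z, l z ∂P = 0 → (∑ i, l (ω i)) / n = 0) ∧
        (∫ z, l z ∂P = 1 → (∑ i, l (ω i)) / n = 1) := by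
  have hInt : Integrable l P := Integrable.of_bound hl.aestronglyMeasurable 1
    (ae_of_all _ fun z => by
      rw [Real.norm_of_nonneg (hb z).1]
      exact (hb z).2)
  refine Filter.Eventually.and ?_ ?_
  · by_cases h : ∫ z, l z ∂P = 0
    · filter_upwards [ae_pi_mean_eq_of_ae_eq hn
        ((integral_eq_zero_iff_of_nonneg (fun z => (hb z).1) hInt).1 h)] with ω hω _ using hω
    · exact ae_of_all _ fun ω h' => absurd h' h
  · by_cases h : ∫ z, l z ∂P = 1
    · have h0 : ∫ z, (1 - l z) ∂P = 0 := by
        rw [integral_sub (integrable_const 1) hInt, h]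
        simp
      have h1 := (integral_eq_zero_iff_of_nonneg (fun z => sub_nonneg.2 (hb z).2)
        ((integrable_const 1).sub hInt)).1 h0
      have h2 : ∀ᵐ z ∂P, l z = 1 := by
        filter_upwards [h1] with z hz
        exact (sub_eq_zero.1 hz).symm
      filter_upwards [ae_pi_mean_eq_of_ae_eq hn h2] with ω hω _ using hω
    · exact ae_of_all _ fun ω h' => absurd h' h

theorem measurable_klBernoulli {Ω : Type*} [MeasurableSpace Ω] {p q : Ω → ℝ} (hp : Measurable p)
    (hq : Measurable q) : Measurable fun ω => klBernoulli (p ω) (q ω) := by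
  unfold klBernoulli
  fun_prop

theorem loss01_eq_zero_or_one {Y : Type*} (y' y : Y) : loss01 y' y = 0 ∨ loss01 y' y = 1 := by
  unfold loss01
  split_ifs <;> simp

theorem klBernoulli_integral_le_of_integral_exp_le {Θ : Type*} [MeasurableSpace Θ]
    {ρ π : Measure Θ} [IsProbabilityMeasure ρ] [IsProbabilityMeasure π] (hKL : KL ρ π ≠ ⊤)
    {r R : Θ → ℝ} (hr : Measurable r) (hR : Measurable R) (hr01 : ∀ θ, r θ ∈ Set.Icc (0 : ℝ) 1)
    (hR01 : ∀ θ, R θ ∈ Set.Icc (0 : ℝ) 1)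
    (hae : ∀ᵐ θ ∂π, (R θ = 0 → r θ = 0) ∧ (R θ = 1 → r θ = 1)) {n : ℕ} (hn : 0 < n) {A : ℝ}
    (hA : ∫⁻ θ, ENNReal.ofReal (Real.exp (n * klBernoulli (r θ) (R θ))) ∂π ≤ ENNReal.ofReal A) :
    klBernoulli (∫ θ, r θ ∂ρ) (∫ θ, R θ ∂ρ) ≤ ((KL ρ π).toReal + Real.log A) / n := by
  have hn' : (0 : ℝ) < n := by exact_mod_cast hn
  refine klBernoulli_le_of_forall_minorant_le (integral_mem_Icc ρ hr hr01)
    (integral_mem_Icc ρ hR hR01) fun c d hc hd => ?_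
  have hInt {g : Θ → ℝ} (hg : Measurable g) (hg01 : ∀ θ, g θ ∈ Set.Icc (0 : ℝ) 1) :
      Integrable g ρ := Integrable.of_bound hg.aestronglyMeasurable 1 (ae_of_all _ fun θ => by
    rw [Real.norm_of_nonneg (hg01 θ).1]
    exact (hg01 θ).2)
  have e (p q : ℝ) : klBernoulliMinorant c d p q =
      p * (Real.log c - Real.log d) + q * (d - c) + (Real.log d + 1 - d) := by
    rw [klBernoulliMinorant]
    ring
  have hs : Integrable
      (fun θ => r θ * (Real.log c - Real.log d) + R θ * (d - c)) ρ :=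
    ((hInt hr hr01).mul_const _).add ((hInt hR hR01).mul_const _)
  have hTρ : Integrable (fun θ => klBernoulliMinorant c d (r θ) (R θ)) ρ := by
    simp only [e]
    exact hs.add (integrable_const _)
  have hT : ∫ θ, klBernoulliMinorant c d (r θ) (R θ) ∂ρ =
      klBernoulliMinorant c d (∫ θ, r θ ∂ρ) (∫ θ, R θ ∂ρ) := by
    simp only [e]
    rw [integral_add hs (integrable_const _), integral_add ((hInt hr hr01).mul_const _)
      ((hInt hR hR01).mul_const _), integral_mul_const, integral_mul_const]
    simp
  have hTm : Measurable fun θ => Real.exp (n * klBernoulliMinorant c d (r θ) (R θ)) := by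
    simp only [e]
    fun_prop
  have hle : ∫⁻ θ, ENNReal.ofReal (Real.exp (n * klBernoulliMinorant c d (r θ) (R θ))) ∂π ≤
      ENNReal.ofReal A := by
    refine le_trans (lintegral_mono_ae ?_) hA
    filter_upwards [hae] with θ hθ
    exact ENNReal.ofReal_le_ofReal (Real.exp_le_exp.2 (mul_le_mul_of_nonneg_left
      (klBernoulliMinorant_le hc hd (hr01 θ) (hR01 θ) hθ.1 hθ.2) hn'.le))
  have hTπ : Integrable (fun θ => Real.exp (n * klBernoulliMinorant c d (r θ) (R θ))) π :=
    (lintegral_ofReal_ne_top_iff_integrable hTm.aestronglyMeasurable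
      (ae_of_all _ fun _ => (Real.exp_pos _).le)).1 (hle.trans_lt ENNReal.ofReal_lt_top).ne
  have hpos := integral_exp_pos hTπ
  have hle' : ∫ θ, Real.exp (n * klBernoulliMinorant c d (r θ) (R θ)) ∂π ≤ A := by
    rw [← ofReal_integral_eq_lintegral_ofReal hTπ (ae_of_all _ fun _ => (Real.exp_pos _).le)] at hle
    by_contra! h
    exact absurd hle (not_le.2 ((ENNReal.ofReal_lt_ofReal_iff hpos).2 h))
  have h := integral_le_KL_add_log_integral_exp hKL (hTρ.const_mul (n : ℝ)) hTπ
  rw [integral_const_mul, hT] at h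
  rw [le_div_iff₀' hn']
  exact h.trans (add_le_add le_rfl (Real.log_le_log hpos hle'))

/-- Seeger–Maurer PAC-Bayes bound for the 0-1 loss: with probability at least `1 - ε`,
simultaneously for all `ρ ∈ P(Θ)` (with `KL(ρ‖π) < ∞`; otherwise the bound is vacuous),
`kl( E_{θ∼ρ}[r(θ)] | E_{θ∼ρ}[R(θ)] ) ≤ (KL(ρ‖π) + log(2√n/ε))/n`. -/
theorem seeger_maurer_pac_bayes_bound
    {X Y Θ : Type*} [MeasurableSpace X] [MeasurableSpace Y] [MeasurableSpace Θ]
    (P : Measure (X × Y)) [IsProbabilityMeasure P]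
    (f : Θ → X → Y)
    (hmeas : Measurable (fun p : Θ × X × Y => loss01 (f p.1 p.2.1) p.2.2))
    (π : Measure Θ) [IsProbabilityMeasure π]
    (n : ℕ) (hn : 0 < n) (ε : ℝ) (hε : ε ∈ Set.Ioo (0:ℝ) 1) :
    ENNReal.ofReal (1 - ε) ≤
      (Measure.pi fun _ : Fin n => P)
        {ω | ∀ ρ : Measure Θ, IsProbabilityMeasure ρ → KL ρ π ≠ ⊤ →
          klBernoulli (∫ θ, empRisk01 f n ω θ ∂ρ) (∫ θ, risk01 P f θ ∂ρ) ≤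
            ((KL ρ π).toReal + Real.log (2 * Real.sqrt n / ε)) / n} := by
  have hZ (θ : Θ) : Measurable fun z : X × Y => loss01 (f θ z.1) z.2 :=
    hmeas.comp measurable_prodMk_left
  have hR : Measurable (risk01 P f) :=
    (StronglyMeasurable.integral_prod_right' hmeas.stronglyMeasurable).measurable
  have hR01 (θ : Θ) : risk01 P f θ ∈ Set.Icc (0 : ℝ) 1 :=
    integral_mem_Icc P (hZ θ) fun _ => loss01_mem_Icc _ _
  have hr : Measurable fun q : (Fin n → X × Y) × Θ => empRisk01 f n q.1 q.2 :=
    (Finset.measurable_fun_sum _ fun i _ => hmeas.comp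
      (measurable_snd.prodMk ((measurable_pi_apply i).comp measurable_fst))).div_const _
  have hE : Measurable fun q : (Fin n → X × Y) × Θ =>
      ENNReal.ofReal (Real.exp (n * klBernoulli (empRisk01 f n q.1 q.2) (risk01 P f q.2))) :=
    ((measurable_klBernoulli hr (hR.comp measurable_snd)).const_mul (n : ℝ)).exp.ennreal_ofReal
  have hsq : 0 < Real.sqrt n := Real.sqrt_pos.2 (by exact_mod_cast hn)
  set μ := Measure.pi fun _ : Fin n => P
  set W : (Fin n → X × Y) → ℝ≥0∞ := fun ω => ∫⁻ θ,
    ENNReal.ofReal (Real.exp (n * klBernoulli (empRisk01 f n ω θ) (risk01 P f θ))) ∂π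
  have hWm : Measurable W := hE.lintegral_prod_right'
  have hW : ∫⁻ ω, W ω ∂μ ≤ ENNReal.ofReal (2 * Real.sqrt n) := by
    rw [lintegral_lintegral_swap hE.aemeasurable]
    refine (lintegral_mono fun θ => lintegral_exp_klBernoulli_le P (hZ θ)
      (fun _ => loss01_eq_zero_or_one _ _) n hn).trans ?_
    simp
  have hae : ∀ᵐ ω ∂μ, ∀ᵐ θ ∂π, (risk01 P f θ = 0 → empRisk01 f n ω θ = 0) ∧
      (risk01 P f θ = 1 → empRisk01 f n ω θ = 1) := by
    refine (Measure.ae_ae_comm ?_).2 (ae_of_all _ fun θ =>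
      ae_pi_mean_eq_of_integral_eq P (hZ θ) (fun _ => loss01_mem_Icc _ _) hn)
    have hR' : Measurable fun q : (Fin n → X × Y) × Θ => risk01 P f q.2 :=
      hR.comp measurable_snd
    have him (a : ℝ) : MeasurableSet {q : (Fin n → X × Y) × Θ |
        risk01 P f q.2 = a → empRisk01 f n q.1 q.2 = a} :=
      (measurableSet_eq_fun hR' measurable_const).imp (measurableSet_eq_fun hr measurable_const)
    exact (him 0).inter (him 1)
  have hbad : μ {ω | ENNReal.ofReal (2 * Real.sqrt n / ε) ≤ W ω} ≤ ENNReal.ofReal ε := by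
    have hpos : 0 < 2 * Real.sqrt n / ε := div_pos (by positivity) hε.1
    refine (meas_ge_le_lintegral_div hWm.aemeasurable (ENNReal.ofReal_pos.2 hpos).ne'
      ENNReal.ofReal_ne_top).trans ?_
    refine (ENNReal.div_le_div_right hW _).trans ?_
    rw [← ENNReal.ofReal_div_of_pos hpos, div_div_cancel₀ (by positivity)]
  calc ENNReal.ofReal (1 - ε) = 1 - ENNReal.ofReal ε := by
        rw [ENNReal.ofReal_sub _ hε.1.le, ENNReal.ofReal_one]
    _ ≤ 1 - μ {ω | ENNReal.ofReal (2 * Real.sqrt n / ε) ≤ W ω} := tsub_le_tsub_left hbad _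
    _ = μ {ω | ENNReal.ofReal (2 * Real.sqrt n / ε) ≤ W ω}ᶜ :=
        (prob_compl_eq_one_sub (measurableSet_le measurable_const hWm)).symm
    _ ≤ _ := by
        refine measure_mono_ae ?_
        filter_upwards [hae] with ω hω hWω ρ _ hKL
        exact klBernoulli_integral_le_of_integral_exp_le hKL (hr.comp measurable_prodMk_left) hR
          (empRisk01_mem_Icc f n ω) hR01 hω hn (not_le.1 (Set.notMem_ofPred_iff.1 hWω)).le
end
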